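/- Let d < 0 be squarefree with d ≢ 5 (mod 8), let O_d be the ring of integers of ℚ(√d), and B_d = PSL(2, O_d). Then the power subgroup B_d² = ⟨x² : x ∈ B_d⟩ is a non-congruence subgroup of B_d if and only if the index [B_d : B_d²] is at least 8. Moreover, if the class number of O_d is at least 3, then B_d² is non-congruence. -/

import Mathlib

set_option linter.unusedSectionVars false

open NumberField Matrix

instance : Fact (Even (Fintype.card (Fin 2))) := ⟨⟨1, rfl⟩⟩

variable (K : Type*) [Field K] [NumberField K]

/-- The subgroup `{±I}` of `SL(2, 𝓞)`, generated by `-I`. -/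
def PM : Subgroup (Matrix.SpecialLinearGroup (Fin 2) (𝓞 K)) :=
  Subgroup.closure {(-1 : Matrix.SpecialLinearGroup (Fin 2) (𝓞 K))}

theorem PM_le_center : PM K ≤ Subgroup.center (Matrix.SpecialLinearGroup (Fin 2) (𝓞 K)) := by
  rw [PM, Subgroup.closure_le]
  rintro x rfl
  rw [SetLike.mem_coe, Subgroup.mem_center_iff]
  intro g
  ext i j
  simp [Matrix.SpecialLinearGroup.coe_mul]

instance PM_normal : (PM K).Normal := by
  constructor
  intro n hn g
  have hc := PM_le_center K hn
  rw [Subgroup.mem_center_iff] at hc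
  rw [hc g, mul_assoc, mul_inv_cancel, mul_one]
  exact hn

/-- `PSL(2, 𝓞)`, the quotient of `SL(2, 𝓞)` by `{±I}`. -/
def PSL := Matrix.SpecialLinearGroup (Fin 2) (𝓞 K) ⧸ PM K

instance : Group (PSL K) := QuotientGroup.Quotient.group (PM K)

/-- The projection `SL(2, 𝓞) → PSL(2, 𝓞)`. -/
def proj : Matrix.SpecialLinearGroup (Fin 2) (𝓞 K) →* PSL K :=
  QuotientGroup.mk' (PM K)

/-- The elementary matrix `T_x = [[1, x], [0, 1]]` in `SL(2, 𝓞)`. -/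
def T (x : 𝓞 K) : Matrix.SpecialLinearGroup (Fin 2) (𝓞 K) :=
  ⟨!![1, x; 0, 1], by simp [Matrix.det_fin_two_of]⟩

/-- The reduction homomorphism `SL(2, 𝓞) → SL(2, 𝓞/π)`. -/
def red (π : Ideal (𝓞 K)) :
    Matrix.SpecialLinearGroup (Fin 2) (𝓞 K) →*
      Matrix.SpecialLinearGroup (Fin 2) ((𝓞 K) ⧸ π) :=
  Matrix.SpecialLinearGroup.map (Ideal.Quotient.mk π)

/-- The principal congruence subgroup `Ḡ(π)` of `PSL(2,𝓞)` : the image in `PSL(2,𝓞)` of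
`{A ∈ SL(2,𝓞) : A ≡ ±I (mod π)}`, the set of matrices reducing to `±I` modulo `π`. -/
def Gbar (π : Ideal (𝓞 K)) : Subgroup (PSL K) :=
  Subgroup.map (proj K)
    (Subgroup.comap (red K π)
      (Subgroup.closure {(-1 : Matrix.SpecialLinearGroup (Fin 2) ((𝓞 K) ⧸ π))}))

/-- A subgroup of `G = PSL(2,𝓞)` is a congruence subgroup if it contains `Ḡ(π)` for some
nonzero ideal `π` of `𝓞`. -/
def IsCongruence (H : Subgroup (PSL K)) : Prop :=
  ∃ π : Ideal (𝓞 K), π ≠ ⊥ ∧ Gbar K π ≤ H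

/-- The normal closure in `PSL(2,𝓞)` of the images of the matrices `T_{mx}`, `x ∈ 𝓞`. -/
def TclosureP (m : ℕ) : Subgroup (PSL K) :=
  Subgroup.normalClosure {x : PSL K | ∃ a : 𝓞 K, x = proj K (T K ((m : 𝓞 K) * a))}

/-- `H ≤ PSL(2,𝓞)` has level `m` : `m` is the smallest positive integer such that the
normal closure in `PSL(2,𝓞)` of the images of `{T_{mx} : x ∈ 𝓞}` is contained in `H`. -/
def HasLevelP (H : Subgroup (PSL K)) (m : ℕ) : Prop :=
  0 < m ∧ TclosureP K m ≤ H ∧ ∀ k : ℕ, 0 < k → TclosureP K k ≤ H → m ≤ k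

/-- The subgroup of a group `G` generated by all squares `x²`, `x ∈ G`. -/
def sqSubgroup (G : Type*) [Group G] : Subgroup G :=
  Subgroup.closure {x : G | ∃ y : G, x = y ^ 2}

namespace ImagQuad

section

variable {a b : ℤ}

local notation "𝓠" => QuadraticAlgebra ℤ a b

open scoped QuadraticAlgebra

theorem four_mul_norm (x : 𝓠) :
    4 * x.norm = (2 * x.re + b * x.im) ^ 2 + (-(b ^ 2 + 4 * a)) * x.im ^ 2 := by
  rw [QuadraticAlgebra.norm_def]; ring

/-- The class of a quadratic integer modulo `n`, recorded by its coordinates. -/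
def modClass (n : ℕ) (x : 𝓠) : ZMod n × ZMod n := (x.re, x.im)

theorem exists_eq_add_of_modClass_eq {n : ℕ} {x y : 𝓠} (h : modClass n x = modClass n y) :
    ∃ z : 𝓠, x = y + n * z := by
  simp only [modClass, Prod.mk.injEq] at h
  obtain ⟨h1, h2⟩ := h
  rw [ZMod.intCast_eq_intCast_iff_dvd_sub] at h1 h2
  obtain ⟨u, hu⟩ := h1
  obtain ⟨v, hv⟩ := h2
  refine ⟨⟨-u, -v⟩, ?_⟩
  ext
  · simp; linarith
  · simp; linarith

variable [hD : Fact (b ^ 2 + 4 * a < 0)]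

theorem norm_nonneg (x : 𝓠) : 0 ≤ x.norm := by
  have h := four_mul_norm x
  have := hD.out
  nlinarith [sq_nonneg (2 * x.re + b * x.im), sq_nonneg x.im,
    mul_nonneg (neg_nonneg.2 hD.out.le) (sq_nonneg x.im)]

theorem norm_eq_zero_iff {x : 𝓠} : x.norm = 0 ↔ x = 0 := by
  refine ⟨fun h0 => ?_, fun h => by simp [h]⟩
  have h := four_mul_norm x
  have hd := hD.out
  have h1 : 0 ≤ (-(b ^ 2 + 4 * a)) * x.im ^ 2 := by
    exact mul_nonneg (by linarith) (sq_nonneg _)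
  have h2 : (-(b ^ 2 + 4 * a)) * x.im ^ 2 = 0 := by nlinarith [sq_nonneg (2 * x.re + b * x.im)]
  have h3 : x.im = 0 := by
    rcases mul_eq_zero.1 h2 with h | h
    · omega
    · exact pow_eq_zero_iff (two_ne_zero) |>.1 h
  have h4 : x.re = 0 := by
    rw [h3, h0] at h
    have : (2 * x.re) ^ 2 = 0 := by nlinarith
    have := pow_eq_zero_iff (two_ne_zero) |>.1 this
    omega
  ext <;> simp [h3, h4]

theorem norm_pos {x : 𝓠} (hx : x ≠ 0) : 0 < x.norm :=
  lt_of_le_of_ne (norm_nonneg x) fun h => hx (norm_eq_zero_iff.1 h.symm)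

instance : IsDomain 𝓠 :=
  have : NoZeroDivisors 𝓠 := ⟨fun {x y} h => by
    have h1 : x.norm * y.norm = 0 := by rw [← map_mul, h]; simp
    rcases mul_eq_zero.1 h1 with h | h
    · exact Or.inl (norm_eq_zero_iff.1 h)
    · exact Or.inr (norm_eq_zero_iff.1 h)⟩
  NoZeroDivisors.to_isDomain _

theorem im_sq_le_norm (x : 𝓠) : x.im ^ 2 ≤ 4 * x.norm := by
  rw [four_mul_norm]
  have := hD.out
  nlinarith [sq_nonneg (2 * x.re + b * x.im),
    mul_nonneg (show 0 ≤ -(b ^ 2 + 4 * a) - 1 by linarith) (sq_nonneg x.im)]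

theorem finite_norm_le (n : ℤ) : {x : 𝓠 | x.norm ≤ n}.Finite := by
  have key : ∀ x : 𝓠, x.norm ≤ n → |x.im| ≤ 4 * n + 1 ∧ |2 * x.re + b * x.im| ≤ 4 * n + 1 := by
    intro x hx
    have h1 := im_sq_le_norm x
    have h2 := four_mul_norm x
    have h3 : 0 ≤ (-(b ^ 2 + 4 * a)) * x.im ^ 2 :=
      mul_nonneg (by linarith [hD.out]) (sq_nonneg _)
    have aux : ∀ y : ℤ, y ^ 2 ≤ 4 * n → |y| ≤ 4 * n + 1 := by
      intro y hy
      rw [← sq_abs] at hy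
      nlinarith [abs_nonneg y, sq_nonneg (|y| - 1)]
    exact ⟨aux _ (by linarith), aux _ (by linarith)⟩
  refine Set.Finite.subset (s := (fun p : ℤ × ℤ => (⟨p.1, p.2⟩ : 𝓠)) ''
    (Set.Icc (-((4 * n + 1) * (|b| + 1))) ((4 * n + 1) * (|b| + 1)) ×ˢ
      Set.Icc (-(4 * n + 1)) (4 * n + 1)))
    (((Set.finite_Icc _ _).prod (Set.finite_Icc _ _)).image _) ?_
  intro x hx
  obtain ⟨h1, h2⟩ := key x hx
  refine ⟨(x.re, x.im), ⟨?_, ?_⟩, rfl⟩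
  · rw [Set.mem_Icc, ← abs_le]
    have h4 : |2 * x.re| ≤ (4 * n + 1) + |b| * (4 * n + 1) := by
      calc |2 * x.re| = |(2 * x.re + b * x.im) - b * x.im| := by ring_nf
        _ ≤ |2 * x.re + b * x.im| + |b * x.im| := abs_sub _ _
        _ ≤ _ := by rw [abs_mul]; gcongr
    rw [abs_mul, abs_two] at h4
    show |x.re| ≤ _
    nlinarith [abs_nonneg x.re]
  · rw [Set.mem_Icc, ← abs_le]; exact h1

/-- Simultaneous approximation by pigeonhole. -/
theorem exists_approx (x y δ : 𝓠) (hδ : δ ≠ 0) :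
    ∃ j : ℕ, 1 ≤ j ∧ j ≤ (1 + a.natAbs + b.natAbs) ^ 4 ∧ ∃ l m : 𝓠,
      (j * x - l * δ).norm < δ.norm ∧ (j * y - m * δ).norm < δ.norm := by
  set M : ℕ := 1 + a.natAbs + b.natAbs with hM
  have hN := norm_pos hδ
  set N := δ.norm with hNdef
  let box : ℤ → ℤ := fun z => z % N * M / N
  have hM0 : (0 : ℤ) < M := by positivity
  have hbox : ∀ z, box z ∈ Finset.Ico (0 : ℤ) M := by
    intro z
    rw [Finset.mem_Ico]
    constructor
    · exact Int.ediv_nonneg (mul_nonneg (Int.emod_nonneg _ hN.ne') hM0.le) hN.le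
    · apply Int.ediv_lt_of_lt_mul hN
      rw [mul_comm]
      exact mul_lt_mul_of_pos_left (Int.emod_lt_of_pos _ hN) hM0
  have hbox2 : ∀ z z', box z = box z' → |(z % N - z' % N) * M| < N := by
    intro z z' h
    have h1 := Int.emod_add_mul_ediv (z % N * M) N
    have h2 := Int.emod_add_mul_ediv (z' % N * M) N
    have e : z % N * M / N = z' % N * M / N := h
    have h3 := Int.emod_nonneg (z % N * M) hN.ne'
    have h4 := Int.emod_nonneg (z' % N * M) hN.ne'
    have h5 := Int.emod_lt_of_pos (z % N * M) hN
    have h6 := Int.emod_lt_of_pos (z' % N * M) hN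
    rw [e] at h1
    rw [abs_lt]
    constructor <;> nlinarith
  let f : ℕ → (ℤ × ℤ) × (ℤ × ℤ) := fun j =>
    ((box (j * x * star δ).re, box (j * x * star δ).im),
      (box (j * y * star δ).re, box (j * y * star δ).im))
  obtain ⟨j₁, hj₁, j₂, hj₂, hne, hf⟩ := Finset.exists_ne_map_eq_of_card_lt_of_maps_to
    (s := Finset.range (M ^ 4 + 1))
    (t := (Finset.Ico (0 : ℤ) M ×ˢ Finset.Ico (0 : ℤ) M) ×ˢ
      (Finset.Ico (0 : ℤ) M ×ˢ Finset.Ico (0 : ℤ) M)) (f := f) (by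
        simp only [Finset.card_product, Int.card_Ico, Finset.card_range, sub_zero, Int.toNat_natCast]
        ring_nf; omega)
      (fun j _ => by
        simp only [Finset.coe_product, Set.mem_prod, Finset.mem_coe]
        exact ⟨⟨hbox _, hbox _⟩, ⟨hbox _, hbox _⟩⟩)
  wlog hlt : j₁ < j₂ generalizing j₁ j₂
  · exact this j₂ hj₂ j₁ hj₁ hne.symm hf.symm (by omega)
  simp only [f, Prod.mk.injEq] at hf
  obtain ⟨⟨e1, e2⟩, e3, e4⟩ := hf
  rw [Finset.mem_range] at hj₂
  have main : ∀ x : 𝓠, box (j₁ * x * star δ).re = box (j₂ * x * star δ).re →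
      box (j₁ * x * star δ).im = box (j₂ * x * star δ).im →
      ∃ l : 𝓠, (((j₂ - j₁ : ℕ) : 𝓠) * x - l * δ).norm < N := by
    intro x e1 e2
    set u := (j₁ : 𝓠) * x * star δ with hu
    set v := (j₂ : 𝓠) * x * star δ with hv
    have f1 := hbox2 _ _ e1
    have f2 := hbox2 _ _ e2
    let l : 𝓠 := ⟨v.re / N - u.re / N, v.im / N - u.im / N⟩
    refine ⟨l, ?_⟩
    have hz : (((j₂ - j₁ : ℕ) : 𝓠) * x - l * δ) * star δ
        = ⟨v.re % N - u.re % N, v.im % N - u.im % N⟩ := by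
      have h1 : δ * star δ = (N : 𝓠) := by
        rw [← QuadraticAlgebra.algebraMap_norm_eq_mul_star]; rfl
      have h2 : (((j₂ - j₁ : ℕ) : 𝓠) * x - l * δ) * star δ = v - u - l * (δ * star δ) := by
        rw [Nat.cast_sub hlt.le, hu, hv]; ring
      rw [h2, h1]
      have r1 := Int.emod_add_mul_ediv v.re N
      have r2 := Int.emod_add_mul_ediv u.re N
      have r3 := Int.emod_add_mul_ediv v.im N
      have r4 := Int.emod_add_mul_ediv u.im N
      ext
      · simp [l]; linarith
      · simp [l]; linarith
    have hn : (((j₂ - j₁ : ℕ) : 𝓠) * x - l * δ).norm * N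
        = (v.re % N - u.re % N) * (v.re % N - u.re % N)
          + b * (v.re % N - u.re % N) * (v.im % N - u.im % N)
          - a * (v.im % N - u.im % N) * (v.im % N - u.im % N) := by
      rw [← QuadraticAlgebra.norm_def ⟨v.re % N - u.re % N, v.im % N - u.im % N⟩, ← hz, map_mul,
        QuadraticAlgebra.norm_star]
    rw [← abs_neg, show -((u.re % N - v.re % N) * M) = (v.re % N - u.re % N) * M by ring, abs_mul,
      abs_of_pos hM0] at f1
    rw [← abs_neg, show -((u.im % N - v.im % N) * M) = (v.im % N - u.im % N) * M by ring, abs_mul,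
      abs_of_pos hM0] at f2
    set r := v.re % N - u.re % N
    set s := v.im % N - u.im % N
    set W := (((j₂ - j₁ : ℕ) : 𝓠) * x - l * δ).norm
    have g1 : r * r * M ^ 2 ≤ N ^ 2 := by
      have : (|r| * M) ^ 2 ≤ N ^ 2 := by gcongr
      rw [mul_pow, sq_abs] at this; linarith
    have g2 : s * s * M ^ 2 < N ^ 2 := by
      have : (|s| * M) ^ 2 < N ^ 2 := by gcongr
      rw [mul_pow, sq_abs] at this; linarith
    have g3 : |r * s| * M ^ 2 ≤ N ^ 2 := by
      rw [abs_mul]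
      calc |r| * |s| * M ^ 2 = (|r| * M) * (|s| * M) := by ring
        _ ≤ N * N := by gcongr
        _ = _ := by ring
    have ha : a < 0 := by nlinarith [hD.out, sq_nonneg b]
    have g4 : b * (r * s) ≤ |b| * |r * s| := by rw [← abs_mul]; exact le_abs_self _
    have hMc : (M : ℤ) = 1 + |a| + |b| := by
      rw [hM]; push_cast; rfl
    have g5 : W * N * M ^ 2 < M * N ^ 2 := by
      rw [hn]
      calc (r * r + b * r * s - a * s * s) * M ^ 2
          = r * r * M ^ 2 + (b * (r * s)) * M ^ 2 + (-a) * (s * s * M ^ 2) := by ring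
        _ ≤ N ^ 2 + (|b| * |r * s|) * M ^ 2 + (-a) * (s * s * M ^ 2) := by gcongr
        _ = N ^ 2 + |b| * (|r * s| * M ^ 2) + (-a) * (s * s * M ^ 2) := by ring
        _ < N ^ 2 + |b| * (N ^ 2) + (-a) * (N ^ 2) := by
            have := mul_le_mul_of_nonneg_left g3 (abs_nonneg b)
            have := mul_lt_mul_of_pos_left g2 (neg_pos.2 ha)
            linarith
        _ = M * N ^ 2 := by rw [hMc, abs_of_neg ha]; ring
    have g6 : (M : ℤ) * N ^ 2 ≤ N * N * M ^ 2 := by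
      have : (1 : ℤ) ≤ M := hM0
      nlinarith [mul_nonneg (sq_nonneg N) (mul_nonneg (sub_nonneg.2 this) hM0.le)]
    have g7 : W * (N * M ^ 2) < N * (N * M ^ 2) := by linarith
    exact lt_of_mul_lt_mul_right g7 (by positivity)
  obtain ⟨l, hl⟩ := main x e1 e2
  obtain ⟨m, hm⟩ := main y e3 e4
  exact ⟨j₂ - j₁, by omega, by omega, l, m, hl, hm⟩

end

section

/-- The determinant of two vectors of the plane. -/
def cross {R : Type*} [CommRing R] (v w : Fin 2 → R) : R := v 0 * w 1 - v 1 * w 0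

section general
variable {R : Type*} [CommRing R]

local notation "𝓖" => Matrix.SpecialLinearGroup (Fin 2) R

theorem det_eq_one (g : 𝓖) : g.1 0 0 * g.1 1 1 - g.1 0 1 * g.1 1 0 = 1 := by
  rw [← Matrix.det_fin_two]; exact g.2

/-- The matrix with rows `(x, y)` and `(z, w)` as an element of `SL(2, R)`. -/
def sl (x y z w : R) (h : x * w - y * z = 1) : 𝓖 :=
  ⟨!![x, y; z, w], by rw [Matrix.det_fin_two_of, h]⟩

section entries
variable (x y z w : R) (h : x * w - y * z = 1)
@[simp] theorem sl_00 : (sl x y z w h).1 0 0 = x := rfl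
@[simp] theorem sl_01 : (sl x y z w h).1 0 1 = y := rfl
@[simp] theorem sl_10 : (sl x y z w h).1 1 0 = z := rfl
@[simp] theorem sl_11 : (sl x y z w h).1 1 1 = w := rfl
end entries

theorem mul_entry (g h : 𝓖) (i j : Fin 2) :
    (g * h).1 i j = g.1 i 0 * h.1 0 j + g.1 i 1 * h.1 1 j := by
  have := congrFun (congrFun (Matrix.SpecialLinearGroup.coe_mul g h) i) j
  rw [Matrix.mul_apply, Fin.sum_univ_two] at this
  exact this

theorem inv_00 (g : 𝓖) : (g⁻¹).1 0 0 = g.1 1 1 := by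
  rw [Matrix.SpecialLinearGroup.SL2_inv_expl]; rfl
theorem inv_01 (g : 𝓖) : (g⁻¹).1 0 1 = -g.1 0 1 := by
  rw [Matrix.SpecialLinearGroup.SL2_inv_expl]; rfl
theorem inv_10 (g : 𝓖) : (g⁻¹).1 1 0 = -g.1 1 0 := by
  rw [Matrix.SpecialLinearGroup.SL2_inv_expl]; rfl
theorem inv_11 (g : 𝓖) : (g⁻¹).1 1 1 = g.1 0 0 := by
  rw [Matrix.SpecialLinearGroup.SL2_inv_expl]; rfl

theorem sl_ext {g h : 𝓖} (h00 : g.1 0 0 = h.1 0 0) (h01 : g.1 0 1 = h.1 0 1)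
    (h10 : g.1 1 0 = h.1 1 0) (h11 : g.1 1 1 = h.1 1 1) : g = h := by
  refine Matrix.SpecialLinearGroup.ext _ _ fun i j => ?_
  fin_cases i <;> fin_cases j <;> assumption

theorem cross_mulVec (g : 𝓖) (v w : Fin 2 → R) :
    cross (g.1 *ᵥ v) (g.1 *ᵥ w) = cross v w := by
  simp only [cross, Matrix.mulVec, dotProduct, Fin.sum_univ_two]
  linear_combination (v 0 * w 1 - v 1 * w 0) * det_eq_one g

theorem cross_self (v : Fin 2 → R) : cross v v = 0 := by simp only [cross]; ring

theorem cross_comm_zero {v w : Fin 2 → R} (h : cross v w = 0) : cross w v = 0 := by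
  simp only [cross] at *; linear_combination -h

theorem cross_trans [IsDomain R] {u v w : Fin 2 → R} (hv : v ≠ 0) (h1 : cross u v = 0)
    (h2 : cross v w = 0) : cross u w = 0 := by
  simp only [cross] at *
  have h : ∃ i, v i ≠ 0 := by by_contra! h; exact hv (funext h)
  obtain ⟨i, hi⟩ := h
  fin_cases i
  · refine (mul_eq_zero.1 ?_).resolve_left hi
    simp only [Fin.zero_eta, Fin.isValue]
    linear_combination w 0 * h1 + u 0 * h2
  · refine (mul_eq_zero.1 ?_).resolve_left hi
    simp only [Fin.mk_one, Fin.isValue]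
    linear_combination w 1 * h1 + u 1 * h2

theorem mulVec_mul (g h : 𝓖) (v : Fin 2 → R) : (g * h).1 *ᵥ v = g.1 *ᵥ (h.1 *ᵥ v) := by
  rw [Matrix.SpecialLinearGroup.coe_mul, Matrix.mulVec_mulVec]

theorem inv_mulVec_cancel (g : 𝓖) (v : Fin 2 → R) : (g⁻¹).1 *ᵥ (g.1 *ᵥ v) = v := by
  rw [← mulVec_mul]; simp

theorem mulVec_ne_zero (g : 𝓖) {v : Fin 2 → R} (hv : v ≠ 0) : g.1 *ᵥ v ≠ 0 := by
  intro h
  apply hv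
  rw [← inv_mulVec_cancel g v, h, Matrix.mulVec_zero]

end general

/-- A function whose value is controlled by a parameter in a finite set has finite image. -/
theorem finite_image_of_factors {X Y F : Type*} {A : Set X} (f : X → Y) (c : X → F)
    (hfin : (c '' A).Finite) (h : ∀ x ∈ A, ∀ y ∈ A, c x = c y → f x = f y) :
    (f '' A).Finite := by
  classical
  rcases A.eq_empty_or_nonempty with rfl | ⟨x0, hx0⟩
  · simp
  let g : F → Y := fun z => if hz : ∃ x ∈ A, c x = z then f hz.choose else f x0
  refine (hfin.image g).subset ?_
  rintro _ ⟨x, hx, rfl⟩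
  refine ⟨c x, ⟨x, hx, rfl⟩, ?_⟩
  have hz : ∃ y ∈ A, c y = c x := ⟨x, hx, rfl⟩
  simp only [g, dif_pos hz]
  exact h _ hz.choose_spec.1 _ hx hz.choose_spec.2

/-- Representatives for a parameter with finitely many values. -/
theorem exists_finite_reps {X F : Type*} (A : Set X) (c : X → F) (hfin : (c '' A).Finite) :
    ∃ S ⊆ A, S.Finite ∧ ∀ x ∈ A, ∃ y ∈ S, c y = c x := by
  obtain ⟨S, hS, hb⟩ := Set.exists_subset_bijOn A c
  refine ⟨S, hS, ?_, ?_⟩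
  · exact Set.Finite.of_finite_image (hfin.subset (Set.image_mono hS)) hb.injOn
  · intro x hx
    exact hb.surjOn ⟨x, hx, rfl⟩

theorem mul_comm_of_sq_eq_one {Q : Type*} [Group Q] (hQ : ∀ x : Q, x * x = 1) (x y : Q) :
    x * y = y * x := by
  have h1 : ∀ z : Q, z⁻¹ = z := fun z => inv_eq_of_mul_eq_one_left (hQ z)
  rw [← h1 (x * y), _root_.mul_inv_rev, h1, h1]

theorem finite_closure_of_sq_eq_one {Q : Type*} [Group Q] (hQ : ∀ x : Q, x * x = 1) {s : Set Q}
    (hs : s.Finite) : (Subgroup.closure s : Set Q).Finite := by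
  let _ : CommGroup Q := { (inferInstance : Group Q) with mul_comm := mul_comm_of_sq_eq_one hQ }
  have h1 : Group.FG (Subgroup.closure s) := by
    have := hs.to_subtype
    exact Group.closure_finite_fg s
  have h2 : IsMulTorsion (Subgroup.closure s) := by
    intro x
    rw [isOfFinOrder_iff_pow_eq_one]
    refine ⟨2, by norm_num, ?_⟩
    ext
    simp [pow_two, hQ]
  have := CommGroup.finite_of_fg_isMulTorsion (Subgroup.closure s) h2
  exact Set.toFinite _

section transporters

variable {a b : ℤ}

local notation "𝓠" => QuadraticAlgebra ℤ a b
local notation "𝓖" => Matrix.SpecialLinearGroup (Fin 2) (QuadraticAlgebra ℤ a b)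

open scoped QuadraticAlgebra

variable [hD : Fact (b ^ 2 + 4 * a < 0)]

theorem trace_eq_two_of_fix {R : Type*} [CommRing R] [IsDomain R]
    (p : Matrix.SpecialLinearGroup (Fin 2) R) {v : Fin 2 → R} (hv : v ≠ 0) (h : p.1 *ᵥ v = v) :
    p.1 0 0 + p.1 1 1 = 2 := by
  have h0 := congrFun h 0
  have h1 := congrFun h 1
  simp only [Matrix.mulVec, dotProduct, Fin.sum_univ_two] at h0 h1
  have hd := det_eq_one p
  have hh : ∃ i, v i ≠ 0 := by by_contra! h; exact hv (funext h)
  obtain ⟨i, hi⟩ := hh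
  rw [← sub_eq_zero]
  fin_cases i
  · refine (mul_eq_zero.1 ?_).resolve_left hi
    simp only [Fin.zero_eta, Fin.isValue]
    linear_combination (v 0) * hd + p.1 0 1 * h1 + (1 - p.1 1 1) * h0
  · refine (mul_eq_zero.1 ?_).resolve_left hi
    simp only [Fin.mk_one, Fin.isValue]
    linear_combination (v 1) * hd + p.1 1 0 * h0 + (1 - p.1 0 0) * h1

/-- Unipotent elements congruent to `1` modulo `2` are squares. -/
theorem exists_sq_of_fix (p : 𝓖) {v : Fin 2 → 𝓠} (hv : v ≠ 0) (h : p.1 *ᵥ v = v)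
    (x y z w : 𝓠) (h00 : p.1 0 0 = 1 + 2 * x) (h01 : p.1 0 1 = 2 * y)
    (h10 : p.1 1 0 = 2 * z) (h11 : p.1 1 1 = 1 + 2 * w) : ∃ s : 𝓖, s * s = p := by
  have ht := trace_eq_two_of_fix p hv h
  have hd := det_eq_one p
  rw [h00, h11] at ht
  rw [h00, h01, h10, h11] at hd
  have e1 : x + w = 0 := by
    have : (2 : 𝓠) * (x + w) = 0 := by linear_combination ht
    exact (mul_eq_zero.1 this).resolve_left two_ne_zero
  have e2 : x * w - y * z = 0 := by
    have : (2 : 𝓠) * (2 * (x * w - y * z)) = 0 := by linear_combination hd - 2 * e1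
    exact (mul_eq_zero.1 ((mul_eq_zero.1 this).resolve_left two_ne_zero)).resolve_left two_ne_zero
  refine ⟨sl (1 + x) y z (1 + w) (by linear_combination e1 + e2), sl_ext ?_ ?_ ?_ ?_⟩
  all_goals simp only [mul_entry, sl_00, sl_01, sl_10, sl_11, h00, h01, h10, h11]
  · linear_combination -e2 + x * e1
  · linear_combination y * e1
  · linear_combination z * e1
  · linear_combination -e2 + w * e1

theorem finite_image_stabilizer {Q : Type*} [Group Q] (hQ : ∀ x : Q, x * x = 1)
    (q : Matrix.SpecialLinearGroup (Fin 2) (QuadraticAlgebra ℤ a b) →* Q)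
    {v : Fin 2 → 𝓠} (hv : v ≠ 0) :
    (q '' {g : 𝓖 | g.1 *ᵥ v = v}).Finite := by
  refine finite_image_of_factors q
    (fun g : 𝓖 => fun (i j : Fin 2) => modClass 2 (g.1 i j)) (Set.toFinite _) ?_
  intro k hk k' hk' hc
  have key : ∀ i j, ∃ z, k.1 i j = k'.1 i j + 2 * z := fun i j =>
    exists_eq_add_of_modClass_eq (congrFun (congrFun hc i) j)
  choose Z hZ using key
  have hd := det_eq_one k'
  obtain ⟨s, hs⟩ := exists_sq_of_fix (k'⁻¹ * k) hv
    (by rw [mulVec_mul, hk, ← hk', inv_mulVec_cancel, hk'])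
    (k'.1 1 1 * Z 0 0 - k'.1 0 1 * Z 1 0) (k'.1 1 1 * Z 0 1 - k'.1 0 1 * Z 1 1)
    (-k'.1 1 0 * Z 0 0 + k'.1 0 0 * Z 1 0) (-k'.1 1 0 * Z 0 1 + k'.1 0 0 * Z 1 1)
    (by rw [mul_entry, inv_00, inv_01, hZ, hZ 1 0]; linear_combination hd)
    (by rw [mul_entry, inv_00, inv_01, hZ, hZ 1 1]; ring)
    (by rw [mul_entry, inv_10, inv_11, hZ, hZ 1 0]; ring)
    (by rw [mul_entry, inv_10, inv_11, hZ, hZ 1 1]; linear_combination hd)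
  have h1 : q (k'⁻¹ * k) = 1 := by rw [← hs, map_mul, hQ]
  rw [map_mul, map_inv, inv_mul_eq_one] at h1
  exact h1.symm

theorem exists_eq_mul_of_quadratic {R : Type*} [CommRing R] [IsDomain R] [IsIntegrallyClosed R]
    {x y τ : R} (hy : y ≠ 0) (h : x ^ 2 - τ * x * y + y ^ 2 = 0) : ∃ u, x = u * y := by
  have hy' : algebraMap R (FractionRing R) y ≠ 0 := by
    rwa [Ne, FaithfulSMul.algebraMap_eq_zero_iff]
  obtain ⟨z, hz⟩ : ∃ z, z * algebraMap R (FractionRing R) y = algebraMap R (FractionRing R) x :=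
    ⟨_, div_mul_cancel₀ _ hy'⟩
  have hz2 : z ^ 2 - algebraMap R (FractionRing R) τ * z + 1 = 0 := by
    have h' := congrArg (algebraMap R (FractionRing R)) h
    simp only [map_add, map_sub, map_mul, map_pow, map_zero, ← hz] at h'
    have : algebraMap R (FractionRing R) y ^ 2 *
        (z ^ 2 - algebraMap R (FractionRing R) τ * z + 1) = 0 := by linear_combination h'
    exact (mul_eq_zero.1 this).resolve_left (pow_ne_zero 2 hy')
  have integral : IsIntegral R z := by
    refine ⟨Polynomial.X ^ 2 - Polynomial.C τ * Polynomial.X + 1, ?_, ?_⟩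
    · monicity!
    · simpa [Polynomial.eval₂_add] using hz2
  obtain ⟨u, hu⟩ := IsIntegrallyClosed.algebraMap_eq_of_integral integral
  refine ⟨u, ?_⟩
  apply IsFractionRing.injective R (FractionRing R)
  rw [map_mul, hu, hz]

theorem exists_unit_of_cross_eq_zero [IsIntegrallyClosed 𝓠] (k : 𝓖) {v : Fin 2 → 𝓠} (hv : v ≠ 0)
    (h : cross (k.1 *ᵥ v) v = 0) : ∃ u : 𝓠, u.norm = 1 ∧ k.1 *ᵥ v = u • v := by
  have hd := det_eq_one k
  have hdvd : ∀ i, v i ≠ 0 → ∃ u, (k.1 *ᵥ v) i = u * v i ∧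
      u * u - (k.1 0 0 + k.1 1 1) * u + 1 = 0 := by
    intro i hi
    set τ := k.1 0 0 + k.1 1 1 with hτ
    have hq : (k.1 *ᵥ v) i ^ 2 - τ * (k.1 *ᵥ v) i * v i + v i ^ 2 = 0 := by
      have h' := h
      simp only [cross, Matrix.mulVec, dotProduct, Fin.sum_univ_two] at h' ⊢
      fin_cases i
      · simp only [Fin.zero_eta, Fin.isValue, hτ]
        linear_combination k.1 0 1 * h' - (v 0) ^ 2 * hd
      · simp only [Fin.mk_one, Fin.isValue, hτ]
        linear_combination -k.1 1 0 * h' - (v 1) ^ 2 * hd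
    obtain ⟨u, hu⟩ := exists_eq_mul_of_quadratic hi hq
    refine ⟨u, hu, ?_⟩
    rw [hu] at hq
    have : v i ^ 2 * (u * u - τ * u + 1) = 0 := by linear_combination hq
    exact (mul_eq_zero.1 this).resolve_left (pow_ne_zero 2 hi)
  have hh : ∃ i, v i ≠ 0 := by by_contra! h; exact hv (funext h)
  obtain ⟨i, hi⟩ := hh
  obtain ⟨u, hu, hu2⟩ := hdvd i hi
  refine ⟨u, ?_, ?_⟩
  · have h3 : u * ((k.1 0 0 + k.1 1 1) - u) = 1 := by linear_combination -hu2
    have h4 := congrArg QuadraticAlgebra.norm h3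
    rw [map_mul, map_one] at h4
    exact Int.eq_one_of_mul_eq_one_right (norm_nonneg u) h4
  · refine funext fun j => ?_
    simp only [Pi.smul_apply, smul_eq_mul]
    refine mul_left_cancel₀ hi ?_
    clear hdvd hu2
    simp only [cross] at h
    fin_cases i <;> fin_cases j
    all_goals simp only [Fin.zero_eta, Fin.mk_one, Fin.isValue] at hu ⊢
    · rw [hu, mul_comm]
    · linear_combination v 1 * hu - h
    · linear_combination v 0 * hu + h
    · rw [hu, mul_comm]

theorem finite_image_transporter [IsIntegrallyClosed 𝓠] {Q : Type*} [Group Q]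
    (hQ : ∀ x : Q, x * x = 1)
    (q : Matrix.SpecialLinearGroup (Fin 2) (QuadraticAlgebra ℤ a b) →* Q)
    {v w : Fin 2 → 𝓠} (hv : v ≠ 0) (hw : w ≠ 0) :
    (q '' {g : 𝓖 | cross (g.1 *ᵥ v) w = 0}).Finite := by
  have coset : ∀ (A B : Set 𝓖), (q '' A).Finite → (∀ g ∈ B, ∀ h ∈ B, h⁻¹ * g ∈ A) →
      (q '' B).Finite := by
    intro A B hA hAB
    rcases B.eq_empty_or_nonempty with rfl | ⟨h, hh⟩
    · simp
    refine (hA.image (fun x => q h * x)).subset ?_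
    rintro _ ⟨g, hg, rfl⟩
    exact ⟨q (h⁻¹ * g), ⟨_, hAB g hg h hh, rfl⟩, by simp⟩
  have h1 : ∀ u : 𝓠, (q '' {g : 𝓖 | g.1 *ᵥ v = u • v}).Finite := by
    intro u
    refine coset _ _ (finite_image_stabilizer hQ q hv) ?_
    intro g hg h hh
    simp only [Set.mem_ofPred_eq] at hg hh ⊢
    rw [mulVec_mul, hg, ← hh, inv_mulVec_cancel]
  have h2 : (q '' {g : 𝓖 | cross (g.1 *ᵥ v) v = 0}).Finite := by
    refine ((finite_norm_le (a := a) (b := b) 1).biUnion fun u _ => h1 u).subset ?_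
    rintro _ ⟨g, hg, rfl⟩
    obtain ⟨u, hu, hu2⟩ := exists_unit_of_cross_eq_zero g hv hg
    simp only [Set.mem_iUnion]
    exact ⟨u, hu.le, g, hu2, rfl⟩
  refine coset _ _ h2 ?_
  intro g hg h hh
  simp only [Set.mem_ofPred_eq] at hg hh ⊢
  rw [mulVec_mul]
  rw [← cross_mulVec h]
  have : h.1 *ᵥ ((h⁻¹).1 *ᵥ (g.1 *ᵥ v)) = g.1 *ᵥ v := by
    rw [← mulVec_mul]; simp
  rw [this]
  exact cross_trans hw hg (cross_comm_zero hh)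

end transporters
end

section

variable {a b : ℤ}

local notation "𝓠" => QuadraticAlgebra ℤ a b
local notation "𝓖" => Matrix.SpecialLinearGroup (Fin 2) (QuadraticAlgebra ℤ a b)

open scoped QuadraticAlgebra

/-- The pair `(v, w)` spans a lattice containing `κ` times the standard one. -/
def IsEdge (κ : ℕ) (v w : Fin 2 → 𝓠) : Prop :=
  cross v w ≠ 0 ∧ ∀ i, cross v w ∣ κ * v i ∧ cross v w ∣ κ * w i

variable [hD : Fact (b ^ 2 + 4 * a < 0)]

theorem IsEdge.exists_mulVec_eq {κ : ℕ} {v w v' w' : Fin 2 → 𝓠} (h : IsEdge κ v w)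
    (hdet : cross v' w' = cross v w) (hv : ∀ i, modClass κ (v' i) = modClass κ (v i))
    (hw : ∀ i, modClass κ (w' i) = modClass κ (w i)) :
    ∃ g : 𝓖, v' = g.1 *ᵥ v ∧ w' = g.1 *ᵥ w := by
  choose z hz using fun i => exists_eq_add_of_modClass_eq (hv i)
  choose y hy using fun i => exists_eq_add_of_modClass_eq (hw i)
  obtain ⟨hne, hdvd⟩ := h
  choose p hp using fun i => (hdvd i).1
  choose r hr using fun i => (hdvd i).2
  set δ := cross v w with hδ
  have e : δ = v 0 * w 1 - v 1 * w 0 := rfl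
  have e' : δ = v' 0 * w' 1 - v' 1 * w' 0 := hdet.symm
  have g00 : ∀ i, z i * r 1 * v 0 - y i * p 1 * v 0 - z i * r 0 * v 1 + y i * p 0 * v 1
      = κ * z i := by
    intro i
    apply mul_left_cancel₀ hne
    linear_combination (κ * z i) * (-e) - z i * v 0 * hr 1 + y i * v 0 * hp 1 + z i * v 1 * hr 0
      - y i * v 1 * hp 0
  have g01 : ∀ i, z i * r 1 * w 0 - y i * p 1 * w 0 - z i * r 0 * w 1 + y i * p 0 * w 1
      = κ * y i := by
    intro i
    apply mul_left_cancel₀ hne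
    linear_combination (κ * y i) * (-e) - z i * w 0 * hr 1 + y i * w 0 * hp 1 + z i * w 1 * hr 0
      - y i * w 1 * hp 0
  let A : Matrix (Fin 2) (Fin 2) 𝓠 := fun i j =>
    if j = 0 then z i * r 1 - y i * p 1 else y i * p 0 - z i * r 0
  have hA0 : ∀ i, A i 0 = z i * r 1 - y i * p 1 := fun i => rfl
  have hA1 : ∀ i, A i 1 = y i * p 0 - z i * r 0 := fun i => rfl
  have hv0 : v' 0 = (1 + A 0 0) * v 0 + A 0 1 * v 1 := by
    rw [hA0, hA1]; linear_combination hz 0 - g00 0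
  have hv1 : v' 1 = A 1 0 * v 0 + (1 + A 1 1) * v 1 := by
    rw [hA0, hA1]; linear_combination hz 1 - g00 1
  have hw0 : w' 0 = (1 + A 0 0) * w 0 + A 0 1 * w 1 := by
    rw [hA0, hA1]; linear_combination hy 0 - g01 0
  have hw1 : w' 1 = A 1 0 * w 0 + (1 + A 1 1) * w 1 := by
    rw [hA0, hA1]; linear_combination hy 1 - g01 1
  refine ⟨sl (1 + A 0 0) (A 0 1) (A 1 0) (1 + A 1 1) ?_, ?_, ?_⟩
  · apply mul_left_cancel₀ hne
    clear_value A
    clear hA0 hA1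
    rw [hv0, hv1, hw0, hw1] at e'
    linear_combination -e' + ((1 + A 0 0) * (1 + A 1 1) - A 0 1 * A 1 0) * e
  · funext i
    fin_cases i
    · simpa [Matrix.mulVec, dotProduct, Fin.sum_univ_two] using hv0
    · simpa [Matrix.mulVec, dotProduct, Fin.sum_univ_two] using hv1
  · funext i
    fin_cases i
    · simpa [Matrix.mulVec, dotProduct, Fin.sum_univ_two] using hw0
    · simpa [Matrix.mulVec, dotProduct, Fin.sum_univ_two] using hw1

theorem IsEdge.norm_cross_le {κ : ℕ} {v w : Fin 2 → 𝓠} (h : IsEdge κ v w) (hκ : κ ≠ 0) :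
    (cross v w).norm ≤ (κ : ℤ) ^ 4 := by
  obtain ⟨hne, hdvd⟩ := h
  choose p hp using fun i => (hdvd i).1
  choose r hr using fun i => (hdvd i).2
  have e : cross v w = v 0 * w 1 - v 1 * w 0 := rfl
  have h1 : cross v w * (p 0 * r 1 - p 1 * r 0) = ((κ ^ 2 : ℕ) : 𝓠) := by
    apply mul_left_cancel₀ hne
    push_cast
    linear_combination (-κ ^ 2) * e - cross v w * p 0 * hr 1 - κ * w 1 * hp 0
      + κ * w 0 * hp 1 + cross v w * p 1 * hr 0
  have h2 := congrArg QuadraticAlgebra.norm h1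
  rw [map_mul, QuadraticAlgebra.norm_natCast] at h2
  have h3 : (p 0 * r 1 - p 1 * r 0) ≠ 0 := by
    intro h0
    rw [h0, mul_zero] at h1
    exact (pow_ne_zero 2 hκ) (by exact_mod_cast h1.symm)
  have h4 := norm_pos h3
  have h5 := norm_nonneg (cross v w)
  push_cast at h2
  nlinarith

/-- A quotient of exponent two of `SL(2)` over an imaginary quadratic ring is finite. -/
theorem finite_of_sq_eq_one [IsIntegrallyClosed 𝓠] {Q : Type*} [Group Q]
    (hQ : ∀ x : Q, x * x = 1)
    (q : Matrix.SpecialLinearGroup (Fin 2) (QuadraticAlgebra ℤ a b) →* Q)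
    (hq : Function.Surjective q) : Finite Q := by
  set κ : ℕ := ((1 + a.natAbs + b.natAbs) ^ 4).factorial with hκdef
  have hκ : κ ≠ 0 := Nat.factorial_ne_zero _
  have : NeZero κ := ⟨hκ⟩
  -- finitely many edges up to the action of the group
  obtain ⟨S, hSsub, hSfin, hS⟩ := exists_finite_reps
    {e : (Fin 2 → 𝓠) × (Fin 2 → 𝓠) | IsEdge κ e.1 e.2}
    (fun e => ((fun i => modClass κ (e.1 i), fun i => modClass κ (e.2 i)), cross e.1 e.2))
    (((Set.finite_univ (α := (Fin 2 → ZMod κ × ZMod κ) × (Fin 2 → ZMod κ × ZMod κ))).prod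
      (finite_norm_le (a := a) (b := b) ((κ : ℤ) ^ 4))).subset (by
        rintro _ ⟨e, he, rfl⟩
        exact ⟨Set.mem_univ _, IsEdge.norm_cross_le he hκ⟩))
  let e₁ : Fin 2 → 𝓠 := ![1, 0]
  have he₁ : e₁ ≠ 0 := fun h => one_ne_zero (congrFun h 0)
  let V : Set (Fin 2 → 𝓠) := {e₁} ∪ (Prod.fst '' S ∪ Prod.snd '' S)
  have hVfin : V.Finite :=
    (Set.finite_singleton _).union ((hSfin.image _).union (hSfin.image _))
  have hV0 : ∀ v ∈ V, v ≠ 0 := by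
    rintro v (rfl | ⟨e, he, rfl⟩ | ⟨e, he, rfl⟩)
    · exact he₁
    · intro h0; exact (hSsub he).1 (by rw [h0]; simp [cross])
    · intro h0; exact (hSsub he).1 (by rw [h0]; simp [cross])
  let gens : Set Q := ⋃ v ∈ V, ⋃ w ∈ V, q '' {g : 𝓖 | cross (g.1 *ᵥ v) w = 0}
  have hgens : gens.Finite := hVfin.biUnion fun v hv => hVfin.biUnion fun w hw =>
    finite_image_transporter hQ q (hV0 v hv) (hV0 w hw)
  have hmem : ∀ v ∈ V, ∀ w ∈ V, ∀ g : 𝓖, cross (g.1 *ᵥ v) w = 0 →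
      q g ∈ Subgroup.closure gens := by
    intro v hv w hw g hg
    refine Subgroup.subset_closure ?_
    simp only [gens, Set.mem_iUnion]
    exact ⟨v, hv, w, hw, g, hg, rfl⟩
  let P : (Fin 2 → 𝓠) → Prop := fun w =>
    ∀ v ∈ V, ∀ g : 𝓖, cross (g.1 *ᵥ v) w = 0 → q g ∈ Subgroup.closure gens
  have hPpar : ∀ v w, w ≠ 0 → cross v w = 0 → P v → P w := by
    intro v w hw hvw hP u hu g hg
    exact hP u hu g (cross_trans hw hg (cross_comm_zero hvw))
  have hPedge : ∀ v w, IsEdge κ v w → P v → P w := by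
    intro v w he hP u hu g hg
    obtain ⟨⟨r₁, r₂⟩, hr, hc⟩ := hS (v, w) he
    simp only [Prod.mk.injEq] at hc
    obtain ⟨⟨c1, c2⟩, c3⟩ := hc
    obtain ⟨γ, hγ1, hγ2⟩ := IsEdge.exists_mulVec_eq (hSsub hr) c3.symm
      (fun i => (congrFun c1 i).symm) (fun i => (congrFun c2 i).symm)
    have hr₁ : r₁ ∈ V := Or.inr (Or.inl ⟨_, hr, rfl⟩)
    have hr₂ : r₂ ∈ V := Or.inr (Or.inr ⟨_, hr, rfl⟩)
    have m1 : q γ ∈ Subgroup.closure gens := hP r₁ hr₁ γ (by rw [hγ1]; exact cross_self _)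
    have m2 : q (γ⁻¹ * g) ∈ Subgroup.closure gens := by
      refine hmem u hu r₂ hr₂ _ ?_
      rw [← cross_mulVec γ, ← mulVec_mul, mul_inv_cancel_left]
      simp only at hγ2
      rw [← hγ2]; exact hg
    have := Subgroup.mul_mem _ m1 m2
    rwa [← map_mul, mul_inv_cancel_left] at this
  have hconn : ∀ n : ℕ, ∀ v w : Fin 2 → 𝓠, v ≠ 0 → w ≠ 0 → (cross v w).norm.toNat = n →
      P v → P w := by
    intro n
    induction n using Nat.strong_induction_on with
    | _ n ih =>
    intro v w hv hw hn hP
    by_cases h0 : cross v w = 0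
    · exact hPpar v w hw h0 hP
    by_cases hE : IsEdge κ v w
    · exact hPedge v w hE hP
    have hn' : (n : ℤ) = (cross v w).norm := by
      rw [← hn, Int.toNat_of_nonneg (norm_nonneg _)]
    have step : ∀ u : Fin 2 → 𝓠, u ≠ 0 → (cross v u).norm < (cross v w).norm →
        (cross u w).norm < (cross v w).norm → P w := by
      intro u hu h1 h2
      have hPu : P u := ih _ (by have := norm_nonneg (cross v u); omega) v u hv hu rfl hP
      exact ih _ (by have := norm_nonneg (cross u w); omega) u w hu hw rfl hPu
    have approx : ∀ e : Fin 2 → 𝓠, P w ∨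
        (cross v w ∣ κ * cross v e ∧ cross v w ∣ κ * cross e w) := by
      intro e
      obtain ⟨j, hj1, hj2, l, m, hl, hm⟩ := exists_approx (cross v e) (cross e w) (cross v w) h0
      let u : Fin 2 → 𝓠 := fun i => j * e i - m * v i - l * w i
      have hu1 : cross v u = j * cross v e - l * cross v w := by
        simp only [cross, u]; ring
      have hu2 : cross u w = j * cross e w - m * cross v w := by
        simp only [cross, u]; ring
      by_cases hu : u = 0
      · right
        have hj : j ∣ κ := Nat.dvd_factorial hj1 hj2
        obtain ⟨t, ht⟩ := hj
        rw [hu] at hu1 hu2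
        have e1 : cross v (0 : Fin 2 → 𝓠) = 0 := by simp [cross]
        have e2 : cross (0 : Fin 2 → 𝓠) w = 0 := by simp [cross]
        rw [e1] at hu1
        rw [e2] at hu2
        rw [ht]
        push_cast
        exact ⟨⟨t * l, by linear_combination -t * hu1⟩, ⟨t * m, by linear_combination -t * hu2⟩⟩
      · left
        exact step u hu (by rw [hu1]; exact hl) (by rw [hu2]; exact hm)
    rcases approx ![1, 0] with h | ⟨h1, h2⟩
    · exact h
    rcases approx ![0, 1] with h | ⟨h3, h4⟩
    · exact h
    refine absurd ⟨h0, fun i => ?_⟩ hE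
    simp only [cross, Matrix.cons_val_zero, Matrix.cons_val_one] at h1 h2 h3 h4
    fin_cases i
    · refine ⟨?_, ?_⟩
      · simpa [cross] using h3
      · simpa [cross] using h4
    · refine ⟨?_, ?_⟩
      · simpa [cross] using h1
      · simpa [cross] using h2
  have hP₁ : P e₁ := fun v hv g hg => hmem v hv e₁ (Or.inl rfl) g hg
  have htop : ∀ x : Q, x ∈ Subgroup.closure gens := by
    intro x
    obtain ⟨g, rfl⟩ := hq x
    exact hconn _ e₁ (g.1 *ᵥ e₁) he₁ (mulVec_ne_zero g he₁) rfl hP₁ e₁ (Or.inl rfl) g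
      (cross_self _)
  exact Set.finite_univ_iff.1 ((finite_closure_of_sq_eq_one hQ hgens).subset fun x _ => htop x)

end

section

section general
variable {R : Type*} [CommRing R]

local notation "𝓖" => Matrix.SpecialLinearGroup (Fin 2) R

/-- The upper elementary matrix. -/
def upper (x : R) : 𝓖 := sl 1 x 0 1 (by ring)

/-- The lower elementary matrix. -/
def lower (x : R) : 𝓖 := sl 1 0 x 1 (by ring)

theorem upper_mul_upper (x y : R) : upper x * upper y = upper (x + y) := by
  apply sl_ext <;> simp only [upper, mul_entry, sl_00, sl_01, sl_10, sl_11] <;> ring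

theorem lower_eq_conj (x : R) :
    lower x = sl 0 (-1) 1 0 (by ring) * upper (-x) * (sl 0 (-1) 1 0 (by ring))⁻¹ := by
  apply sl_ext <;>
    simp only [upper, lower, mul_entry, inv_00, inv_01, inv_10, inv_11, sl_00, sl_01, sl_10, sl_11]
      <;> ring

theorem exists_isUnit_add_mul [Finite R] {x y : R} (h : ∃ u v, u * x + v * y = 1) :
    ∃ t, IsUnit (x + t * y) := by
  obtain ⟨i, j, hij, he⟩ := Finite.exists_ne_map_eq_of_infinite (fun k : ℕ => x ^ k)
  wlog hlt : i < j generalizing i j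
  · exact this j i hij.symm he.symm (by omega)
  obtain ⟨m, rfl⟩ := Nat.exists_eq_add_of_lt hlt
  set p := m + 1 with hp
  have hper : ∀ k s, i ≤ s → x ^ (s + k * p) = x ^ s := by
    intro k
    induction k with
    | zero => simp
    | succ k ih =>
      intro s hs
      obtain ⟨r, rfl⟩ := Nat.exists_eq_add_of_le hs
      calc x ^ (i + r + (k + 1) * p) = x ^ (i + m + 1) * x ^ (r + k * p) := by
            rw [← pow_add]; congr 1; rw [hp]; ring
        _ = x ^ (i + r + k * p) := by rw [← he, ← pow_add]; congr 1; ring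
        _ = x ^ (i + r) := ih _ hs
  set s := (i + 1) * p with hs
  have hi : i ≤ s := by rw [hs]; nlinarith
  have hs0 : s ≠ 0 := by positivity
  have hidem : x ^ s * x ^ s = x ^ s := by
    rw [← pow_add]; exact hper (i + 1) s hi
  refine ⟨1 - x ^ s, ?_⟩
  by_contra hu
  obtain ⟨M, hM, hmem⟩ := exists_max_ideal_of_mem_nonunits hu
  have hprime := hM.isPrime
  by_cases hx : x ∈ M
  · have h1 : (1 - x ^ s) * y ∈ M := by
      have := M.sub_mem hmem hx
      rwa [add_sub_cancel_left] at this
    have h2 : x ^ s ∈ M := M.pow_mem_of_mem hx _ (Nat.pos_of_ne_zero hs0)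
    have h3 : y ∈ M := by
      refine (hprime.mem_or_mem h1).resolve_left fun h => hprime.ne_top ?_
      rw [Ideal.eq_top_iff_one]
      have := M.add_mem h h2
      rwa [sub_add_cancel] at this
    obtain ⟨u, v, huv⟩ := h
    apply hprime.ne_top
    rw [Ideal.eq_top_iff_one, ← huv]
    exact M.add_mem (M.mul_mem_left _ hx) (M.mul_mem_left _ h3)
  · have h2 : x ^ s ∉ M := fun h => hx (hprime.mem_of_pow_mem _ h)
    have h3 : x ^ s * (1 - x ^ s) ∈ M := by
      have : x ^ s * (1 - x ^ s) = 0 := by rw [mul_sub, hidem]; ring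
      rw [this]; exact M.zero_mem
    have h4 := (hprime.mem_or_mem h3).resolve_left h2
    have := M.sub_mem hmem (M.mul_mem_right y h4)
    rw [add_sub_cancel_right] at this
    exact hx this

/-- Over a finite ring, elementary matrices generate `SL(2)`. -/
theorem mem_of_elementary [Finite R] (H : Subgroup 𝓖) (hU : ∀ x, upper x ∈ H)
    (hL : ∀ x, lower x ∈ H) (g : 𝓖) : g ∈ H := by
  have hW : ∀ u v (h : 0 * 0 - u * (-v) = (1 : R)), sl 0 u (-v) 0 h ∈ H := by
    intro u v h
    have : sl 0 u (-v) 0 h = upper u * lower (-v) * upper u := by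
      apply sl_ext <;> simp only [upper, lower, mul_entry, sl_00, sl_01, sl_10, sl_11]
      · linear_combination h
      · linear_combination u * h
      · ring
      · linear_combination h
    rw [this]
    exact H.mul_mem (H.mul_mem (hU _) (hL _)) (hU _)
  have hdiag : ∀ u v (h : u * v - 0 * 0 = (1 : R)), sl u 0 0 v h ∈ H := by
    intro u v h
    have : sl u 0 0 v h = sl 0 u (-v) 0 (by linear_combination h) *
        sl 0 (-1) (-(-1)) 0 (by ring) := by
      apply sl_ext <;> simp only [mul_entry, sl_00, sl_01, sl_10, sl_11] <;> ring
    rw [this]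
    exact H.mul_mem (hW _ _ _) (hW _ _ _)
  have hd := det_eq_one g
  obtain ⟨t, ht⟩ := exists_isUnit_add_mul (x := g.1 0 0) (y := g.1 1 0)
    ⟨g.1 1 1, -g.1 0 1, by linear_combination hd⟩
  obtain ⟨v, hv⟩ := ht.exists_right_inv
  have hg : upper t * g = lower (g.1 1 0 * v) *
      sl (g.1 0 0 + t * g.1 1 0) 0 0 v (by linear_combination hv) *
      upper (v * (g.1 0 1 + t * g.1 1 1)) := by
    apply sl_ext <;> simp only [upper, lower, mul_entry, sl_00, sl_01, sl_10, sl_11]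
    · ring
    · linear_combination -(g.1 0 1 + t * g.1 1 1) * hv
    · linear_combination -g.1 1 0 * hv
    · linear_combination v * hd - (g.1 1 0 * v * (g.1 0 1 + t * g.1 1 1) + g.1 1 1) * hv
  have h1 : upper t * g ∈ H := by
    rw [hg]
    exact H.mul_mem (H.mul_mem (hL _) (hdiag _ _ _)) (hU _)
  exact (H.mul_mem_cancel_left (hU t)).1 h1

end general

variable {a b : ℤ}

local notation "𝓠" => QuadraticAlgebra ℤ a b
local notation "𝓖" => Matrix.SpecialLinearGroup (Fin 2) (QuadraticAlgebra ℤ a b)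

open scoped QuadraticAlgebra

theorem finite_quotient_natCast {n : ℕ} (hn : n ≠ 0) : Finite (𝓠 ⧸ Ideal.span {(n : 𝓠)}) := by
  have : NeZero n := ⟨hn⟩
  choose s hs using fun x : 𝓠 ⧸ Ideal.span {(n : 𝓠)} => Ideal.Quotient.mk_surjective x
  refine Finite.of_injective (fun x => modClass n (s x)) fun x y h => ?_
  obtain ⟨z, hz⟩ := exists_eq_add_of_modClass_eq h
  rw [← hs x, ← hs y, Ideal.Quotient.eq, hz, add_sub_cancel_left]
  exact Ideal.mul_mem_right _ _ (Ideal.mem_span_singleton_self _)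

/-- Congruence quotients of exponent two have at most four elements. -/
theorem card_le_four {Q : Type*} [Group Q] (hQ : ∀ x : Q, x * x = 1)
    (q : Matrix.SpecialLinearGroup (Fin 2) (QuadraticAlgebra ℤ a b) →* Q)
    (hq : Function.Surjective q) {n : ℕ} (hn : n ≠ 0)
    (hker : ∀ g : Matrix.SpecialLinearGroup (Fin 2) (QuadraticAlgebra ℤ a b),
      (∀ i j, (n : QuadraticAlgebra ℤ a b) ∣ g.1 i j - (1 : Matrix (Fin 2) (Fin 2) _) i j) →
        q g = 1) :
    Nat.card Q ≤ 4 := by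
  have hcomm := mul_comm_of_sq_eq_one hQ
  let I : Ideal 𝓠 := Ideal.span {(n : 𝓠)}
  have hfin : Finite (𝓠 ⧸ I) := finite_quotient_natCast hn
  let ρ : 𝓖 →* Matrix.SpecialLinearGroup (Fin 2) (𝓠 ⧸ I) :=
    Matrix.SpecialLinearGroup.map (Ideal.Quotient.mk I)
  have hρ : ∀ g i j, (ρ g).1 i j = Ideal.Quotient.mk I (g.1 i j) := fun g i j => rfl
  let E : Subgroup 𝓖 := Subgroup.closure (Set.range upper ∪ Set.range lower)
  have hlow : ∀ x : 𝓠, q (lower x) = q (upper (-x)) := by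
    intro x
    rw [lower_eq_conj, map_mul, map_mul, hcomm (q (sl _ _ _ _ _)), map_inv, mul_inv_cancel_right]
  have hE : ∀ g ∈ E, ∃ x : 𝓠, q g = q (upper x) := by
    intro g hg
    induction hg using Subgroup.closure_induction with
    | mem g hg =>
      rcases hg with ⟨x, rfl⟩ | ⟨x, rfl⟩
      · exact ⟨x, rfl⟩
      · exact ⟨-x, hlow x⟩
    | one =>
      refine ⟨0, ?_⟩
      have : upper (0 : 𝓠) = 1 := by
        apply sl_ext <;> simp [upper]
      rw [this]
    | mul g h _ _ ihg ihh =>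
      obtain ⟨x, hx⟩ := ihg
      obtain ⟨y, hy⟩ := ihh
      exact ⟨x + y, by rw [map_mul, hx, hy, ← map_mul, upper_mul_upper]⟩
    | inv g _ ihg =>
      obtain ⟨x, hx⟩ := ihg
      exact ⟨x, by rw [map_inv, inv_eq_of_mul_eq_one_left (hQ _), hx]⟩
  have hsurj : ∀ y : Q, ∃ x : 𝓠, q (upper x) = y := by
    intro y
    obtain ⟨g, rfl⟩ := hq y
    have hmem : ρ g ∈ E.map ρ := by
      refine mem_of_elementary _ (fun x => ?_) (fun x => ?_) _
      · obtain ⟨x, rfl⟩ := Ideal.Quotient.mk_surjective x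
        refine ⟨upper x, Subgroup.subset_closure (Or.inl ⟨x, rfl⟩), ?_⟩
        apply sl_ext <;> simp [hρ, upper]
      · obtain ⟨x, rfl⟩ := Ideal.Quotient.mk_surjective x
        refine ⟨lower x, Subgroup.subset_closure (Or.inr ⟨x, rfl⟩), ?_⟩
        apply sl_ext <;> simp [hρ, lower]
    obtain ⟨h, hh, he⟩ := hmem
    obtain ⟨x, hx⟩ := hE h hh
    refine ⟨x, ?_⟩
    rw [← hx, ← inv_mul_eq_one, ← map_inv, ← map_mul]
    apply hker
    intro i j
    have h1 : ρ (h⁻¹ * g) = 1 := by rw [map_mul, map_inv, he, inv_mul_cancel]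
    have h2 : (ρ (h⁻¹ * g)).1 i j = Ideal.Quotient.mk I ((1 : Matrix (Fin 2) (Fin 2) 𝓠) i j) := by
      rw [h1]
      fin_cases i <;> fin_cases j <;> simp
    rw [hρ, Ideal.Quotient.eq, Ideal.mem_span_singleton] at h2
    exact h2
  choose s hs using hsurj
  have hinj : Function.Injective fun y => modClass 2 (s y) := by
    intro y z h
    obtain ⟨w, hw⟩ := exists_eq_add_of_modClass_eq h
    have h2 : s y = s z + (w + w) := by rw [hw]; push_cast; ring
    rw [← hs y, h2, ← upper_mul_upper, ← upper_mul_upper, map_mul, map_mul, hQ, mul_one, hs]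
  have := Nat.card_le_card_of_injective _ hinj
  simpa using this

end

section

section general
variable {R : Type*} [CommRing R]

/-- The sign of an element of `SL(2, 𝔽₂) ≃ S₃`, as a function of the entries. -/
def signBit (x y z w : ZMod 2) : ZMod 2 := (1 + x + w) * (y + z + y * z)

theorem signBit_mul : ∀ x y z w x' y' z' w' : ZMod 2, x * w - y * z = 1 → x' * w' - y' * z' = 1 →
    signBit (x * x' + y * z') (x * y' + y * w') (z * x' + w * z') (z * y' + w * w') =
      signBit x y z w + signBit x' y' z' w' := by decide

/-- The invariant linear form on trace zero matrices over `𝔽₂`. -/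
def slForm (x y z : ZMod 2) : ZMod 2 := x + y + z

theorem slForm_conj : ∀ x y z w r s t u : ZMod 2, x * w - y * z = 1 → r + u = 0 →
    slForm ((x * r + y * t) * w - (x * s + y * u) * z) (-((x * r + y * t) * y) + (x * s + y * u) * x)
      ((z * r + w * t) * w - (z * s + w * u) * z) = slForm r s t := by decide

theorem map_det (p : R →+* ZMod 2) (g : Matrix.SpecialLinearGroup (Fin 2) R) :
    p (g.1 0 0) * p (g.1 1 1) - p (g.1 0 1) * p (g.1 1 0) = 1 := by
  rw [← map_mul, ← map_mul, ← map_sub, det_eq_one, map_one]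

/-- The sign character of `SL(2, R)` attached to a residue field `𝔽₂` of `R`. -/
def signHom (p : R →+* ZMod 2) :
    Matrix.SpecialLinearGroup (Fin 2) R →* Multiplicative (ZMod 2) where
  toFun g := .ofAdd (signBit (p (g.1 0 0)) (p (g.1 0 1)) (p (g.1 1 0)) (p (g.1 1 1)))
  map_one' := by
    simp [signBit]
  map_mul' g h := by
    rw [← ofAdd_add, ← signBit_mul _ _ _ _ _ _ _ _ (map_det p g) (map_det p h)]
    simp only [mul_entry, map_add, map_mul]

theorem signHom_upper (p : R →+* ZMod 2) (x : R) : signHom p (upper x) = .ofAdd (p x) := by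
  change Multiplicative.ofAdd _ = _
  simp only [upper, sl_00, sl_01, sl_10, sl_11, map_one, map_zero, signBit]
  congr 1
  generalize p x = y
  revert y; decide

/-- The character of `SL(2, R)` attached to a derivation of `R` into a residue field `𝔽₂`. -/
def derivHom (p : R →+* ZMod 2) (D : R →+ ZMod 2) (hD : ∀ x y, D (x * y) = p x * D y + D x * p y) :
    Matrix.SpecialLinearGroup (Fin 2) R →* Multiplicative (ZMod 2) where
  toFun g := .ofAdd (slForm (D (g.1 0 0) * p (g.1 1 1) - D (g.1 0 1) * p (g.1 1 0))
    (-(D (g.1 0 0) * p (g.1 0 1)) + D (g.1 0 1) * p (g.1 0 0))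
    (D (g.1 1 0) * p (g.1 1 1) - D (g.1 1 1) * p (g.1 1 0)))
  map_one' := by
    have h1 : D 1 = 0 := by
      have := hD 1 1
      simp only [mul_one, map_one, one_mul] at this
      simpa using this
    simp [slForm, h1]
  map_mul' g h := by
    have h1 : D 1 = 0 := by
      have := hD 1 1
      simp only [mul_one, map_one, one_mul] at this
      simpa using this
    have hg := map_det p g
    have hh := map_det p h
    have htr : (D (h.1 0 0) * p (h.1 1 1) - D (h.1 0 1) * p (h.1 1 0)) +
        (-(D (h.1 1 0) * p (h.1 0 1)) + D (h.1 1 1) * p (h.1 0 0)) = 0 := by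
      have := congrArg D (det_eq_one h)
      rw [map_sub, hD, hD, h1] at this
      linear_combination this
    rw [← ofAdd_add, ← slForm_conj _ _ _ _ _
      (-(D (h.1 0 0) * p (h.1 0 1)) + D (h.1 0 1) * p (h.1 0 0))
      (D (h.1 1 0) * p (h.1 1 1) - D (h.1 1 1) * p (h.1 1 0)) _ hg htr]
    congr 1
    simp only [mul_entry, map_add, hD, map_mul, slForm]
    generalize p (g.1 0 0) = x at *
    generalize p (g.1 0 1) = y at *
    generalize p (g.1 1 0) = z at *
    generalize p (g.1 1 1) = w at *
    generalize p (h.1 0 0) = x' at *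
    generalize p (h.1 0 1) = y' at *
    generalize p (h.1 1 0) = z' at *
    generalize p (h.1 1 1) = w' at *
    linear_combination (D (g.1 0 0) * w - D (g.1 0 1) * z - D (g.1 0 0) * y + D (g.1 0 1) * x +
      D (g.1 1 0) * w - D (g.1 1 1) * z) * hh

theorem derivHom_upper (p : R →+* ZMod 2) (D : R →+ ZMod 2)
    (hD : ∀ x y, D (x * y) = p x * D y + D x * p y) (x : R) :
    derivHom p D hD (upper x) = .ofAdd (D x) := by
  have h1 : D 1 = 0 := by
    have := hD 1 1
    simp only [mul_one, map_one, one_mul] at this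
    simpa using this
  change Multiplicative.ofAdd _ = _
  simp [upper, slForm, h1]

end general

variable {a b : ℤ}

/-- Away from residue class `5` modulo `8`, there is an elementary abelian quotient of order `4`
of `SL(2)` that factors through reduction modulo `2`. -/
theorem exists_surjective_mod_two (hb : b = 0 ∨ b = 1 ∧ 2 ∣ a) :
    ∃ ψ : Matrix.SpecialLinearGroup (Fin 2) (QuadraticAlgebra ℤ a b) →*
        Multiplicative (ZMod 2) × Multiplicative (ZMod 2), Function.Surjective ψ ∧
      ∀ g h : Matrix.SpecialLinearGroup (Fin 2) (QuadraticAlgebra ℤ a b),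
        (∀ i j, (2 : QuadraticAlgebra ℤ a b) ∣ g.1 i j - h.1 i j) → ψ g = ψ h := by
  have hadd : ∀ D : QuadraticAlgebra ℤ a b →+ ZMod 2, ∀ x y : QuadraticAlgebra ℤ a b,
      2 ∣ x - y → D x = D y := by
    rintro D x y ⟨z, hz⟩
    rw [← sub_eq_zero, ← map_sub, hz, two_mul, map_add]
    exact CharTwo.add_self_eq_zero _
  have hsurj : ∀ ψ : Matrix.SpecialLinearGroup (Fin 2) (QuadraticAlgebra ℤ a b) →*
      Multiplicative (ZMod 2) × Multiplicative (ZMod 2),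
      (∀ u v : ZMod 2, ∃ x, ψ (upper x) = (.ofAdd u, .ofAdd v)) → Function.Surjective ψ := by
    intro ψ h y
    obtain ⟨x, hx⟩ := h y.1.toAdd y.2.toAdd
    exact ⟨_, hx⟩
  have hval : ∀ u : ZMod 2, ((u.val : ℤ) : ZMod 2) = u := by decide
  rcases hb with rfl | ⟨rfl, ha⟩
  · let p : QuadraticAlgebra ℤ a 0 →+* ZMod 2 :=
      { toFun := fun x => x.re + a * x.im
        map_one' := by
          change ((1 : ℤ) : ZMod 2) + a * ((0 : ℤ) : ZMod 2) = 1
          simp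
        map_zero' := by simp
        map_add' := fun x y => by simp; ring
        map_mul' := fun x y => by
          simp
          generalize (x.re : ZMod 2) = x1
          generalize (x.im : ZMod 2) = x2
          generalize (y.re : ZMod 2) = y1
          generalize (y.im : ZMod 2) = y2
          generalize (a : ZMod 2) = a
          revert x1 x2 y1 y2 a; decide }
    let D : QuadraticAlgebra ℤ a 0 →+ ZMod 2 :=
      { toFun := fun x => x.im
        map_zero' := by simp
        map_add' := fun x y => by simp }
    have hpD : ∀ x y, D (x * y) = p x * D y + D x * p y := by
      intro x y
      simp only [D, p, RingHom.coe_mk, MonoidHom.coe_mk, OneHom.coe_mk, AddMonoidHom.coe_mk,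
        ZeroHom.coe_mk, QuadraticAlgebra.im_mul]
      push_cast
      linear_combination -(a : ZMod 2) * x.im * y.im * (CharTwo.two_eq_zero (R := ZMod 2))
    refine ⟨(signHom p).prod (derivHom p D hpD), hsurj _ fun u v => ?_, fun g h hgh => ?_⟩
    · refine ⟨⟨(u.val : ℤ) - a * (v.val : ℤ), v.val⟩, ?_⟩
      rw [MonoidHom.prod_apply, signHom_upper, derivHom_upper]
      simp only [D, p, RingHom.coe_mk, MonoidHom.coe_mk, OneHom.coe_mk, AddMonoidHom.coe_mk,
        ZeroHom.coe_mk, Int.cast_sub, Int.cast_mul, hval, sub_add_cancel]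
    · have h1 := fun i j => hadd D _ _ (hgh i j)
      have h2 := fun i j => hadd p.toAddMonoidHom _ _ (hgh i j)
      simp only [RingHom.toAddMonoidHom_eq_coe, AddMonoidHom.coe_coe] at h2
      simp only [MonoidHom.prod_apply, signHom, derivHom, MonoidHom.coe_mk, OneHom.coe_mk, h1, h2]
  · have ha2 : (a : ZMod 2) = 0 := by rwa [ZMod.intCast_zmod_eq_zero_iff_dvd]
    let p : QuadraticAlgebra ℤ a 1 →+* ZMod 2 :=
      { toFun := fun x => x.re
        map_one' := by
          change ((1 : ℤ) : ZMod 2) = 1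
          simp
        map_zero' := by simp
        map_add' := fun x y => by simp
        map_mul' := fun x y => by simp [ha2] }
    let p' : QuadraticAlgebra ℤ a 1 →+* ZMod 2 :=
      { toFun := fun x => x.re + x.im
        map_one' := by
          change ((1 : ℤ) : ZMod 2) + ((0 : ℤ) : ZMod 2) = 1
          simp
        map_zero' := by simp
        map_add' := fun x y => by simp; ring
        map_mul' := fun x y => by simp [ha2]; ring }
    refine ⟨(signHom p).prod (signHom p'), hsurj _ fun u v => ?_, fun g h hgh => ?_⟩
    · refine ⟨⟨(u.val : ℤ), (v.val : ℤ) - u.val⟩, ?_⟩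
      rw [MonoidHom.prod_apply, signHom_upper, signHom_upper]
      simp only [p', p, RingHom.coe_mk, MonoidHom.coe_mk, OneHom.coe_mk, Int.cast_sub, hval,
        add_sub_cancel]
    · have h1 := fun i j => hadd p'.toAddMonoidHom _ _ (hgh i j)
      have h2 := fun i j => hadd p.toAddMonoidHom _ _ (hgh i j)
      simp only [RingHom.toAddMonoidHom_eq_coe, AddMonoidHom.coe_coe] at h1 h2
      simp only [MonoidHom.prod_apply, signHom, MonoidHom.coe_mk, OneHom.coe_mk, h1, h2]

end

section
open NumberField

theorem exists_int_of_squarefree_mul_sq {d : ℤ} (hd : Squarefree d) {q : ℚ} {m : ℤ}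
    (h : d * q ^ 2 = m) : ∃ k : ℤ, q = k := by
  have hden : (q.den : ℚ) ≠ 0 := by exact_mod_cast q.den_nz
  have h1 : d * q.num ^ 2 = m * (q.den : ℤ) ^ 2 := by
    have h2 : q = q.num / q.den := (Rat.num_div_den q).symm
    rw [h2] at h
    field_simp at h
    rw [mul_comm (m : ℤ)]
    exact_mod_cast h
  have hcop : IsCoprime ((q.den : ℤ) * q.den) (q.num ^ 2) := by
    have : IsCoprime (q.den : ℤ) q.num := by
      rw [isCoprime_comm, Int.isCoprime_iff_nat_coprime]
      simpa using q.reduced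
    rw [← sq]
    exact this.pow
  have h3 : (q.den : ℤ) * q.den ∣ d := by
    refine hcop.dvd_of_dvd_mul_right ⟨m, ?_⟩
    rw [h1]; ring
  have h4 := hd _ h3
  have h5 : q.den = 1 := by
    simpa using Int.isUnit_iff_natAbs_eq.1 h4
  exact ⟨q.num, ((Rat.den_eq_one_iff q).1 h5).symm⟩

variable {K : Type*} [Field K] [NumberField K]

/-- Integers of `ℚ(√d)` have half-integral coordinates. -/
theorem exists_half_integral_coords {d : ℤ} (hd : d < 0) (hsf : Squarefree d)
    (hK : Module.finrank ℚ K = 2) {α : K} (hα : α ^ 2 = d) (x : 𝓞 K) :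
    ∃ m k : ℤ, 2 * (x : K) = m + k * α ∧ 4 ∣ m ^ 2 - d * k ^ 2 := by
  let f : QuadraticAlgebra ℚ (d : ℚ) 0 →ₐ[ℚ] K := QuadraticAlgebra.lift
    ⟨α, by rw [← sq, hα]; simp [Algebra.smul_def]⟩
  have hf : ∀ y, f y = algebraMap ℚ K y.re + algebraMap ℚ K y.im * α := by
    intro y
    simp [f, QuadraticAlgebra.lift, Algebra.smul_def]
  have hinj : Function.Injective f := by
    rw [injective_iff_map_eq_zero]
    intro y hy
    rw [hf] at hy
    have h1 : algebraMap ℚ K (y.re ^ 2) = algebraMap ℚ K (d * y.im ^ 2) := by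
      rw [map_pow, map_mul, map_pow, map_intCast, ← hα]
      linear_combination (algebraMap ℚ K y.re - algebraMap ℚ K y.im * α) * hy
    have h2 := (algebraMap ℚ K).injective h1
    have hd' : (d : ℚ) < 0 := by exact_mod_cast hd
    have him : y.im = 0 := by
      by_contra h
      have := mul_neg_of_neg_of_pos hd' (pow_pos (lt_of_le_of_ne (abs_nonneg y.im)
        (abs_pos.2 h).ne) 2)
      rw [sq_abs] at this
      nlinarith [sq_nonneg y.re]
    have hre : y.re = 0 := by
      rw [him] at h2
      simpa using h2
    ext <;> simp [him, hre]
  have hsurj : Function.Surjective f := by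
    refine (LinearMap.injective_iff_surjective_of_finrank_eq_finrank (f := f.toLinearMap) ?_).1 hinj
    rw [hK, QuadraticAlgebra.finrank_eq_two]
  obtain ⟨y, hy⟩ := hsurj (x : K)
  have integral : IsIntegral ℤ y := by
    have := RingOfIntegers.isIntegral_coe x
    change IsIntegral ℤ (x : K) at this
    rw [← hy] at this
    exact (isIntegral_algHom_iff (f.restrictScalars ℤ) hinj).1 this
  have integral' : IsIntegral ℤ (star y) :=
    map_isIntegral_int (starRingEnd (QuadraticAlgebra ℚ (d : ℚ) 0)) integral
  have hrat : ∀ r : ℚ, IsIntegral ℤ (algebraMap ℚ (QuadraticAlgebra ℚ (d : ℚ) 0) r) →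
      ∃ m : ℤ, r = m := by
    intro r hr
    have := (isIntegral_algHom_iff
      ((Algebra.ofId ℚ (QuadraticAlgebra ℚ (d : ℚ) 0)).restrictScalars ℤ)
      (algebraMap ℚ (QuadraticAlgebra ℚ (d : ℚ) 0)).injective).1 hr
    obtain ⟨m, hm⟩ := IsIntegrallyClosed.isIntegral_iff.1 this
    exact ⟨m, by simpa using hm.symm⟩
  obtain ⟨m, hm⟩ := hrat (2 * y.re) (by
    convert integral.add integral' using 1
    ext <;> simp [QuadraticAlgebra.algebraMap_eq]
    ring)
  obtain ⟨N, hN⟩ := hrat (y.re ^ 2 - d * y.im ^ 2) (by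
    convert integral.mul integral' using 1
    ext <;> simp [QuadraticAlgebra.algebraMap_eq] <;> ring)
  obtain ⟨k, hk⟩ := exists_int_of_squarefree_mul_sq hsf (q := 2 * y.im) (m := m ^ 2 - 4 * N) (by
    push_cast; rw [← hm, ← hN]; ring)
  refine ⟨m, k, ?_, N, ?_⟩
  · rw [← hy, hf, ← map_intCast (algebraMap ℚ K) m, ← map_intCast (algebraMap ℚ K) k, ← hm, ← hk,
      map_mul, map_mul, map_ofNat]
    ring
  · have : ((m ^ 2 - d * k ^ 2 : ℤ) : ℚ) = ((4 * N : ℤ) : ℚ) := by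
      push_cast
      rw [← hm, ← hN, ← hk]; ring
    exact_mod_cast this

theorem nonempty_ringEquiv {a b : ℤ} (hD : b ^ 2 + 4 * a < 0) (w : 𝓞 K) (hw : w * w = a + b * w)
    (hs : ∀ x : 𝓞 K, ∃ u v : ℤ, x = u + v * w) :
    Nonempty (𝓞 K ≃+* QuadraticAlgebra ℤ a b) := by
  let f : QuadraticAlgebra ℤ a b →ₐ[ℤ] 𝓞 K := QuadraticAlgebra.lift
    ⟨w, by rw [hw]; simp⟩
  have hf : ∀ y, f y = (y.re : 𝓞 K) + y.im * w := by
    intro y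
    simp [f, QuadraticAlgebra.lift]
  refine ⟨(RingEquiv.ofBijective f ⟨?_, fun x => ?_⟩).symm⟩
  · rw [injective_iff_map_eq_zero]
    intro y hy
    rw [hf] at hy
    have h1 : (((2 * y.re + b * y.im) ^ 2 : ℤ) : 𝓞 K) = (((b ^ 2 + 4 * a) * y.im ^ 2 : ℤ) : 𝓞 K) := by
      push_cast
      linear_combination (4 * (y.re + b * y.im - y.im * w)) * hy + 4 * (y.im : 𝓞 K) ^ 2 * hw
    have h2 : (2 * y.re + b * y.im) ^ 2 = (b ^ 2 + 4 * a) * y.im ^ 2 := by exact_mod_cast h1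
    have him : y.im = 0 := by
      by_contra h
      have := mul_neg_of_neg_of_pos hD (pow_pos (lt_of_le_of_ne (abs_nonneg y.im)
        (abs_pos.2 h).ne) 2)
      rw [sq_abs] at this
      nlinarith [sq_nonneg (2 * y.re + b * y.im)]
    have hre : y.re = 0 := by
      rw [him] at h2
      simpa using h2
    ext <;> simp [him, hre]
  · obtain ⟨u, v, rfl⟩ := hs x
    exact ⟨⟨u, v⟩, hf _⟩

/-- The ring of integers of an imaginary quadratic field in which `2` is not inert. -/
theorem exists_ringEquiv {d : ℤ} (hd : d < 0) (hsf : Squarefree d) (hd8 : d % 8 ≠ 5)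
    (hK : Module.finrank ℚ K = 2) {α : K} (hα : α ^ 2 = d) :
    ∃ a b : ℤ, b ^ 2 + 4 * a < 0 ∧ (b = 0 ∨ b = 1 ∧ 2 ∣ a) ∧
      Nonempty (𝓞 K ≃+* QuadraticAlgebra ℤ a b) := by
  have hcoords := exists_half_integral_coords hd hsf hK hα
  have h4 : d % 4 ≠ 0 := by
    intro h
    have : (2 : ℤ) * 2 ∣ d := by omega
    have := hsf _ this
    rw [Int.isUnit_iff] at this
    omega
  have hcoe : ∀ n : ℤ, (((n : 𝓞 K) : K)) = n := fun n => map_intCast _ _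
  have h2K : (2 : K) ≠ 0 := two_ne_zero
  by_cases h1 : d % 4 = 1
  · obtain ⟨c, hc⟩ : ∃ c, d = 1 + 8 * c := ⟨d / 8, by omega⟩
    have integral : IsIntegral ℤ ((1 + α) / 2) := by
      refine ⟨Polynomial.X ^ 2 - Polynomial.X - Polynomial.C (2 * c), ?_, ?_⟩
      · rw [sub_sub]
        refine Polynomial.monic_X_pow_sub ?_
        compute_degree
        norm_num
      · simp only [Polynomial.eval₂_sub, Polynomial.eval₂_pow, Polynomial.eval₂_X,
          Polynomial.eval₂_C]
        rw [hc] at hα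
        push_cast at hα
        simp only [algebraMap_int_eq, Int.coe_castRingHom]
        push_cast
        field_simp
        linear_combination hα
    obtain ⟨w, hw⟩ : ∃ w : 𝓞 K, (w : K) = (1 + α) / 2 := ⟨⟨_, integral⟩, rfl⟩
    refine ⟨2 * c, 1, by omega, Or.inr ⟨rfl, Dvd.intro _ rfl⟩,
      nonempty_ringEquiv (by omega) w ?_ fun x => ?_⟩
    · apply RingOfIntegers.ext
      rw [hc] at hα
      push_cast at hα
      simp only [map_mul, map_add, hcoe, hw]
      push_cast
      field_simp
      linear_combination hα
    · obtain ⟨m, k, hmk, hdvd⟩ := hcoords x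
      obtain ⟨l, hl⟩ : ∃ l, m = k + 2 * l := by
        have : (2 : ℤ) ∣ (m - k) * (m + k) := by
          rw [hc] at hdvd
          have : (m - k) * (m + k) = (m ^ 2 - (1 + 8 * c) * k ^ 2) + 2 * (4 * c * k ^ 2) := by ring
          rw [this]
          exact dvd_add (Dvd.dvd.trans (by norm_num) hdvd) (Dvd.intro _ rfl)
        rcases Int.prime_two.dvd_or_dvd this with h | h
        · exact ⟨(m - k) / 2, by omega⟩
        · exact ⟨(m - k) / 2, by omega⟩
      refine ⟨l, k, ?_⟩
      apply RingOfIntegers.ext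
      apply mul_left_cancel₀ h2K
      rw [hmk]
      simp only [map_mul, map_add, hcoe, hw, hl]
      push_cast
      field_simp
      ring
  · have integral : IsIntegral ℤ α := by
      refine ⟨Polynomial.X ^ 2 - Polynomial.C d, Polynomial.monic_X_pow_sub_C _ two_ne_zero, ?_⟩
      rw [Polynomial.eval₂_sub, Polynomial.eval₂_pow, Polynomial.eval₂_X, Polynomial.eval₂_C, hα]
      simp
    obtain ⟨w, hw⟩ : ∃ w : 𝓞 K, (w : K) = α := ⟨⟨_, integral⟩, rfl⟩
    refine ⟨d, 0, by omega, Or.inl rfl, nonempty_ringEquiv (by omega) w ?_ fun x => ?_⟩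
    · apply RingOfIntegers.ext
      simp only [map_mul, map_add, hcoe, hw]
      push_cast
      linear_combination hα
    · obtain ⟨m, k, hmk, hdvd⟩ := hcoords x
      have hmk2 : m % 2 = 0 ∧ k % 2 = 0 := by
        have e : (m ^ 2 - d * k ^ 2) % 4 = 0 := Int.emod_eq_zero_of_dvd hdvd
        have hm4 : m % 4 = 0 ∨ m % 4 = 1 ∨ m % 4 = 2 ∨ m % 4 = 3 := by omega
        have hk4 : k % 4 = 0 ∨ k % 4 = 1 ∨ k % 4 = 2 ∨ k % 4 = 3 := by omega
        have hd4 : d % 4 = 2 ∨ d % 4 = 3 := by omega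
        rcases hm4 with h | h | h | h <;> rcases hk4 with h' | h' | h' | h' <;>
          rcases hd4 with h'' | h'' <;>
          first
          | omega
          | (simp [Int.sub_emod, Int.mul_emod, pow_two, h, h', h''] at e)
      refine ⟨m / 2, k / 2, ?_⟩
      apply RingOfIntegers.ext
      apply mul_left_cancel₀ h2K
      obtain ⟨m', rfl⟩ : ∃ m', m = 2 * m' := ⟨m / 2, by omega⟩
      obtain ⟨k', rfl⟩ : ∃ k', k = 2 * k' := ⟨k / 2, by omega⟩
      rw [hmk]
      simp only [map_mul, map_add, hcoe, hw]
      rw [Int.mul_ediv_cancel_left _ two_ne_zero, Int.mul_ediv_cancel_left _ two_ne_zero]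
      push_cast
      ring

end

section

section crossed
variable {G X : Type*} [Group G]

/-- A set commensurable with its translates. -/
def AlmostInvariant (ρ : G →* Equiv.Perm X) (S : Set X) : Prop :=
  ∀ g, {x | ¬ (ρ g⁻¹ x ∈ S ↔ x ∈ S)}.Finite

open Classical in
/-- The indicator function of a set modulo `2`. -/
noncomputable def bit (S : Set X) (x : X) : ZMod 2 := if x ∈ S then 1 else 0

theorem support_bit_sub {S S' : Set X} {σ τ : X → X} :
    (Function.support fun x => bit S (σ x) - bit S' (τ x)) ⊆ {x | ¬ (σ x ∈ S ↔ τ x ∈ S')} := by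
  intro x hx h
  refine hx ?_
  by_cases h' : τ x ∈ S' <;> simp [bit, h', h]

/-- The parity of the signed number of points entering an almost invariant set. -/
noncomputable def flow (ρ : G →* Equiv.Perm X) (S : Set X) (g : G) : ZMod 2 :=
  ∑ᶠ x, (bit S (ρ g⁻¹ x) - bit S x)

/-- The character attached to an almost invariant set. -/
noncomputable def flowHom (ρ : G →* Equiv.Perm X) (S : Set X) (hS : AlmostInvariant ρ S) :
    G →* Multiplicative (ZMod 2) where
  toFun g := .ofAdd (flow ρ S g)
  map_one' := by simp [flow]
  map_mul' g h := by
    rw [← ofAdd_add, add_comm]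
    congr 1
    have e1 : flow ρ S h = ∑ᶠ x, (bit S (ρ h⁻¹ (ρ g⁻¹ x)) - bit S (ρ g⁻¹ x)) :=
      (finsum_comp_equiv (ρ g⁻¹)).symm
    have hfin : ∀ g, (Function.support fun x => bit S (ρ g⁻¹ x) - bit S x).Finite :=
      fun g => (hS g).subset (support_bit_sub (τ := id))
    have hfin' : (Function.support fun x =>
        bit S (ρ h⁻¹ (ρ g⁻¹ x)) - bit S (ρ g⁻¹ x)).Finite :=
      (hfin h).preimage ((ρ g⁻¹).injective.injOn)
    rw [e1, flow, flow, ← finsum_add_distrib hfin' (hfin g)]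
    refine finsum_congr fun x => ?_
    rw [_root_.mul_inv_rev, map_mul, Equiv.Perm.mul_apply]
    ring

theorem flow_congr {ρ : G →* Equiv.Perm X} {S S' : Set X} (hS : AlmostInvariant ρ S)
    (h : {x | ¬ (x ∈ S ↔ x ∈ S')}.Finite) (g : G) : flow ρ S g = flow ρ S' g := by
  have h1 : (Function.support fun x => bit S x - bit S' x).Finite :=
    h.subset (support_bit_sub (σ := id) (τ := id))
  have h2 : (Function.support fun x => bit S (ρ g⁻¹ x) - bit S' (ρ g⁻¹ x)).Finite :=
    h1.preimage ((ρ g⁻¹).injective.injOn)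
  have h3 : ∑ᶠ x, (bit S (ρ g⁻¹ x) - bit S' (ρ g⁻¹ x)) = ∑ᶠ x, (bit S x - bit S' x) :=
    finsum_comp_equiv (ρ g⁻¹) (f := fun x => bit S x - bit S' x)
  have h4 : (Function.support fun x => bit S (ρ g⁻¹ x) - bit S x).Finite :=
    (hS g).subset (support_bit_sub (τ := id))
  have h5 : flow ρ S g = flow ρ S' g +
      ∑ᶠ x, ((bit S (ρ g⁻¹ x) - bit S' (ρ g⁻¹ x)) - (bit S x - bit S' x)) := by
    have h6 : (Function.support fun x =>
        (bit S (ρ g⁻¹ x) - bit S' (ρ g⁻¹ x)) - (bit S x - bit S' x)).Finite :=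
      (h2.union h1).subset (Function.support_sub _ _)
    have h7 : (Function.support fun x => bit S' (ρ g⁻¹ x) - bit S' x).Finite := by
      refine (h4.union h6).subset ?_
      refine subset_trans (fun x hx => ?_) (Function.support_sub _ _)
      simp only [Function.mem_support] at hx ⊢
      convert hx using 1
      ring
    rw [flow, flow, ← finsum_add_distrib h7 h6]
    refine finsum_congr fun x => ?_
    ring
  rw [h5, finsum_sub_distrib h2 h1, h3, sub_self, add_zero]

end crossed

variable {a b : ℤ}

local notation "𝓠" => QuadraticAlgebra ℤ a b
local notation "𝓖" => Matrix.SpecialLinearGroup (Fin 2) (QuadraticAlgebra ℤ a b)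

open scoped QuadraticAlgebra

/-- `SL(2)` acting on functions of row vectors. -/
def rowAction (a b : ℤ) : Matrix.SpecialLinearGroup (Fin 2) (QuadraticAlgebra ℤ a b) →*
    Equiv.Perm ((Fin 2 → QuadraticAlgebra ℤ a b) → ℤ) where
  toFun g :=
    { toFun := fun F l => F (l ᵥ* g.1)
      invFun := fun F l => F (l ᵥ* (g⁻¹).1)
      left_inv := fun F => by
        funext l
        simp only [Matrix.vecMul_vecMul, ← Matrix.SpecialLinearGroup.coe_mul, inv_mul_cancel,
          Matrix.SpecialLinearGroup.coe_one, Matrix.vecMul_one]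
      right_inv := fun F => by
        funext l
        simp only [Matrix.vecMul_vecMul, ← Matrix.SpecialLinearGroup.coe_mul, mul_inv_cancel,
          Matrix.SpecialLinearGroup.coe_one, Matrix.vecMul_one] }
  map_one' := by
    ext F l
    change F (l ᵥ* (1 : Matrix.SpecialLinearGroup (Fin 2) (QuadraticAlgebra ℤ a b)).1) = F l
    rw [Matrix.SpecialLinearGroup.coe_one, Matrix.vecMul_one]
  map_mul' g h := by
    ext F l
    change F (l ᵥ* (g * h).1) = F ((l ᵥ* g.1) ᵥ* h.1)
    rw [Matrix.vecMul_vecMul, Matrix.SpecialLinearGroup.coe_mul]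

theorem rowAction_apply (g : 𝓖) (F : (Fin 2 → 𝓠) → ℤ) (l : Fin 2 → 𝓠) :
    rowAction a b g F l = F (l ᵥ* g.1) := rfl

/-- The skew-hermitian form `g J g*`, up to the factor `√D`. -/
def wall (g : Matrix.SpecialLinearGroup (Fin 2) (QuadraticAlgebra ℤ a b)) :
    (Fin 2 → QuadraticAlgebra ℤ a b) → ℤ :=
  fun l => ((l ᵥ* g.1) 0 * star ((l ᵥ* g.1) 1)).im

theorem rowAction_wall (g h : 𝓖) : rowAction a b g (wall h) = wall (g * h) := by
  funext l
  rw [rowAction_apply, wall, wall, Matrix.vecMul_vecMul, Matrix.SpecialLinearGroup.coe_mul]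

/-- The set of walls. -/
def walls (a b : ℤ) : Set ((Fin 2 → QuadraticAlgebra ℤ a b) → ℤ) := Set.range wall

theorem rowAction_mem_walls (g : 𝓖) {F : (Fin 2 → 𝓠) → ℤ} :
    rowAction a b g F ∈ walls a b ↔ F ∈ walls a b := by
  have h : ∀ g : 𝓖, ∀ F, F ∈ walls a b → rowAction a b g F ∈ walls a b := by
    rintro g _ ⟨h, rfl⟩
    exact ⟨g * h, (rowAction_wall g h).symm⟩
  refine ⟨fun hF => ?_, h g F⟩
  have := h g⁻¹ _ hF
  rwa [← Equiv.Perm.mul_apply, ← map_mul, inv_mul_cancel, map_one] at this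

/-- The off-diagonal entry of `g J g*`. -/
def offDiag (g : Matrix.SpecialLinearGroup (Fin 2) (QuadraticAlgebra ℤ a b)) :
    QuadraticAlgebra ℤ a b := g.1 0 0 * star (g.1 1 1) - g.1 0 1 * star (g.1 1 0)

theorem vecMul_entry (l : Fin 2 → 𝓠) (g : 𝓖) (i : Fin 2) :
    (l ᵥ* g.1) i = l 0 * g.1 0 i + l 1 * g.1 1 i := by
  simp [Matrix.vecMul, dotProduct, Fin.sum_univ_two]

theorem wall_upper (g : 𝓖) : wall g ![1, 0] = (g.1 0 0 * star (g.1 0 1)).im := by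
  simp only [wall, vecMul_entry, Matrix.cons_val_zero, Matrix.cons_val_one, one_mul, zero_mul,
    add_zero]

theorem wall_lower (g : 𝓖) : wall g ![0, 1] = (g.1 1 0 * star (g.1 1 1)).im := by
  simp only [wall, vecMul_entry, Matrix.cons_val_zero, Matrix.cons_val_one, one_mul, zero_mul,
    zero_add]

theorem wall_apply (g : 𝓖) (l : Fin 2 → 𝓠) :
    wall g l = wall g ![1, 0] * (l 0).norm + wall g ![0, 1] * (l 1).norm +
      (l 0 * offDiag g * star (l 1)).im := by
  rw [wall_upper, wall_lower]
  simp only [wall, vecMul_entry, offDiag, QuadraticAlgebra.norm_def, QuadraticAlgebra.im_mul,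
    QuadraticAlgebra.re_mul, QuadraticAlgebra.im_add, QuadraticAlgebra.re_add,
    QuadraticAlgebra.im_sub, QuadraticAlgebra.re_sub, QuadraticAlgebra.im_star,
    QuadraticAlgebra.re_star]
  ring

theorem wall_det (g : 𝓖) :
    (offDiag g).norm = 1 - (b ^ 2 + 4 * a) * (wall g ![1, 0] * wall g ![0, 1]) := by
  have h : (g.1 0 0 * g.1 1 1 - g.1 0 1 * g.1 1 0).norm = 1 := by
    rw [det_eq_one]; simp
  rw [wall_upper, wall_lower, ← h]
  simp only [offDiag, QuadraticAlgebra.norm_def, QuadraticAlgebra.im_mul,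
    QuadraticAlgebra.re_mul,
    QuadraticAlgebra.im_sub, QuadraticAlgebra.re_sub, QuadraticAlgebra.im_star,
    QuadraticAlgebra.re_star]
  ring

theorem wall_ext {g h : 𝓖} (h0 : wall g ![1, 0] = wall h ![1, 0])
    (h1 : wall g ![0, 1] = wall h ![0, 1]) (h2 : offDiag g = offDiag h) : wall g = wall h := by
  funext l
  rw [wall_apply g, wall_apply h, h0, h1, h2]

variable [hD : Fact (b ^ 2 + 4 * a < 0)]

theorem neg_norm_le_lower (g : 𝓖) (l : Fin 2 → 𝓠) :
    -(l 0).norm ≤ -(b ^ 2 + 4 * a) * (wall g ![0, 1] * wall g l) := by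
  have h := norm_nonneg (l 0 * offDiag g + ((wall g ![0, 1] : ℤ) : 𝓠) * (⟨-b, 2⟩ : 𝓠) * l 1)
  have hd := wall_det g
  suffices (l 0 * offDiag g + ((wall g ![0, 1] : ℤ) : 𝓠) * (⟨-b, 2⟩ : 𝓠) * l 1).norm =
      -(b ^ 2 + 4 * a) * (wall g ![0, 1] * wall g l) + (l 0).norm by linarith
  rw [wall_apply g l]
  generalize wall g ![0, 1] = A at *
  generalize wall g ![1, 0] = C at *
  generalize offDiag g = B at *
  simp only [QuadraticAlgebra.norm_def, QuadraticAlgebra.im_mul,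
    QuadraticAlgebra.re_mul, QuadraticAlgebra.im_add, QuadraticAlgebra.re_add,
    QuadraticAlgebra.im_star, QuadraticAlgebra.re_star,
    QuadraticAlgebra.re_intCast, QuadraticAlgebra.im_intCast, Int.cast_id] at hd ⊢
  linear_combination ((l 0).re * (l 0).re + b * (l 0).re * (l 0).im - a * (l 0).im * (l 0).im) * hd

theorem neg_norm_le_upper (g : 𝓖) (l : Fin 2 → 𝓠) :
    -(l 1).norm ≤ -(b ^ 2 + 4 * a) * (wall g ![1, 0] * wall g l) := by
  have h := norm_nonneg (l 1 * star (offDiag g) - ((wall g ![1, 0] : ℤ) : 𝓠) * (⟨-b, 2⟩ : 𝓠) * l 0)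
  have hd := wall_det g
  suffices (l 1 * star (offDiag g) - ((wall g ![1, 0] : ℤ) : 𝓠) * (⟨-b, 2⟩ : 𝓠) * l 0).norm =
      -(b ^ 2 + 4 * a) * (wall g ![1, 0] * wall g l) + (l 1).norm by linarith
  rw [wall_apply g l]
  generalize wall g ![0, 1] = A at *
  generalize wall g ![1, 0] = C at *
  generalize offDiag g = B at *
  simp only [QuadraticAlgebra.norm_def, QuadraticAlgebra.im_mul,
    QuadraticAlgebra.re_mul, QuadraticAlgebra.im_sub, QuadraticAlgebra.re_sub,
    QuadraticAlgebra.im_star, QuadraticAlgebra.re_star,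
    QuadraticAlgebra.re_intCast, QuadraticAlgebra.im_intCast, Int.cast_id] at hd ⊢
  linear_combination ((l 1).re * (l 1).re + b * (l 1).re * (l 1).im - a * (l 1).im * (l 1).im) * hd

theorem finite_walls_bounded (m : ℤ) :
    {F ∈ walls a b | |F ![1, 0] + F ![0, 1]| ≤ m}.Finite := by
  set N := -(b ^ 2 + 4 * a) * m ^ 2 + 2 with hN
  have hfin : ((fun g : 𝓖 => (wall g ![1, 0], wall g ![0, 1], offDiag g)) ''
      {g | |wall g ![1, 0] + wall g ![0, 1]| ≤ m}).Finite := by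
    refine Set.Finite.subset ((Set.finite_Icc (-N) N).prod
      ((Set.finite_Icc (-N) N).prod (finite_norm_le (a := a) (b := b) N))) ?_
    rintro _ ⟨g, hg, rfl⟩
    have hd := wall_det g
    have h0 := norm_nonneg (offDiag g)
    simp only [Set.mem_ofPred_eq] at hg
    simp only [Set.mem_prod, Set.mem_Icc, Set.mem_ofPred_eq]
    generalize wall g ![0, 1] = A at *
    generalize wall g ![1, 0] = C at *
    have hsq : (C + A) ^ 2 ≤ m ^ 2 := sq_le_sq' (neg_le_of_abs_le hg) (le_of_abs_le hg)
    have hDD : 1 ≤ -(b ^ 2 + 4 * a) := by linarith [hD.out]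
    have hsq' : -(b ^ 2 + 4 * a) * (C + A) ^ 2 ≤ -(b ^ 2 + 4 * a) * m ^ 2 :=
      mul_le_mul_of_nonneg_left hsq (by linarith)
    have hA : A ^ 2 ≤ -(b ^ 2 + 4 * a) * A ^ 2 := le_mul_of_one_le_left (sq_nonneg _) hDD
    have hC : C ^ 2 ≤ -(b ^ 2 + 4 * a) * C ^ 2 := le_mul_of_one_le_left (sq_nonneg _) hDD
    have key : A ^ 2 + C ^ 2 + 2 * (offDiag g).norm ≤ N := by
      rw [hN]; nlinarith
    have habs : ∀ z : ℤ, |z| ≤ z ^ 2 := fun z => by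
      rw [← sq_abs]
      rcases eq_or_ne z 0 with rfl | hz
      · simp
      · nlinarith [Int.one_le_abs hz]
    have h1 := (habs A).trans (show A ^ 2 ≤ N by nlinarith [sq_nonneg C])
    have h2 := (habs C).trans (show C ^ 2 ≤ N by nlinarith [sq_nonneg A])
    rw [abs_le] at h1 h2
    exact ⟨h2, h1, by nlinarith [sq_nonneg C, sq_nonneg A]⟩
  have := finite_image_of_factors (A := {g : 𝓖 | |wall g ![1, 0] + wall g ![0, 1]| ≤ m}) wall _ hfin
    (fun g _ h _ he => by
      simp only [Prod.mk.injEq] at he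
      exact wall_ext he.1 he.2.1 he.2.2)
  refine this.subset ?_
  rintro _ ⟨⟨g, rfl⟩, hg⟩
  exact ⟨g, hg, rfl⟩

theorem finite_walls_separating (l l' : Fin 2 → 𝓠) :
    {F ∈ walls a b | (F ![1, 0] + F ![0, 1]) * (F l + F l') ≤ 0 ∧ F l + F l' ≠ 0}.Finite := by
  refine (finite_walls_bounded (a := a) (b := b)
    ((l 0).norm + (l 1).norm + (l' 0).norm + (l' 1).norm)).subset ?_
  rintro _ ⟨⟨g, rfl⟩, h, h0⟩
  refine ⟨⟨g, rfl⟩, ?_⟩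
  have h1 := neg_norm_le_lower g l
  have h2 := neg_norm_le_upper g l
  have h3 := neg_norm_le_lower g l'
  have h4 := neg_norm_le_upper g l'
  set s := wall g ![1, 0] + wall g ![0, 1] with hs
  set u := wall g l + wall g l' with hu
  have h5 : -((l 0).norm + (l 1).norm + (l' 0).norm + (l' 1).norm) ≤
      -(b ^ 2 + 4 * a) * (s * u) := by
    rw [hs, hu]; linarith
  have h6 : |s * u| = -(s * u) := abs_of_nonpos h
  have h7 : |s| ≤ |s * u| := by
    rw [abs_mul]; exact le_mul_of_one_le_right (abs_nonneg _) (Int.one_le_abs h0)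
  have h8 : |s * u| ≤ -(b ^ 2 + 4 * a) * |s * u| :=
    le_mul_of_one_le_left (abs_nonneg _) (by linarith [hD.out])
  rw [h6] at h7 h8
  linarith

end

section

variable {a b : ℤ}

local notation "𝓠" => QuadraticAlgebra ℤ a b
local notation "𝓖" => Matrix.SpecialLinearGroup (Fin 2) (QuadraticAlgebra ℤ a b)

open scoped QuadraticAlgebra

/-- The walls on the nonnegative side of the base point. -/
def positiveWalls (a b : ℤ) : Set ((Fin 2 → QuadraticAlgebra ℤ a b) → ℤ) :=
  {F ∈ walls a b | 0 ≤ F ![1, 0] + F ![0, 1]}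

theorem bit_congr {X : Type*} {S : Set X} {x y : X} (h : x ∈ S ↔ y ∈ S) : bit S x = bit S y := by
  by_cases hy : y ∈ S
  · rw [bit, bit, if_pos hy, if_pos (h.2 hy)]
  · rw [bit, bit, if_neg hy, if_neg (mt h.1 hy)]

variable [hD : Fact (b ^ 2 + 4 * a < 0)]

theorem almostInvariant_positiveWalls : AlmostInvariant (rowAction a b) (positiveWalls a b) := by
  intro g
  have h1 := finite_walls_separating (a := a) (b := b) (![1, 0] ᵥ* (g⁻¹).1) (![0, 1] ᵥ* (g⁻¹).1)
  have h2 := (finite_walls_separating (a := a) (b := b) (![1, 0] ᵥ* g.1) (![0, 1] ᵥ* g.1)).preimage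
    (f := rowAction a b g⁻¹) ((rowAction a b g⁻¹).injective.injOn)
  refine (h1.union h2).subset ?_
  intro F hF
  have hmem : F ∈ walls a b := by
    by_contra h
    exact hF ⟨fun h' => (h ((rowAction_mem_walls _).1 h'.1)).elim, fun h' => (h h'.1).elim⟩
  have hmem' : rowAction a b g⁻¹ F ∈ walls a b := (rowAction_mem_walls _).2 hmem
  have e : ∀ l, rowAction a b g⁻¹ F (l ᵥ* g.1) = F l := by
    intro l
    rw [rowAction_apply, Matrix.vecMul_vecMul, ← Matrix.SpecialLinearGroup.coe_mul, mul_inv_cancel,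
      Matrix.SpecialLinearGroup.coe_one, Matrix.vecMul_one]
  simp only [positiveWalls, Set.mem_ofPred_eq, hmem, hmem', true_and] at hF
  simp only [Set.mem_union, Set.mem_preimage, Set.mem_ofPred_eq, hmem, hmem', true_and, e]
  simp only [rowAction_apply] at hF ⊢
  generalize F ![1, 0] + F ![0, 1] = u at *
  generalize F (![1, 0] ᵥ* (g⁻¹).1) + F (![0, 1] ᵥ* (g⁻¹).1) = v at *
  rcases le_or_gt 0 u with hu | hu
  · left
    have hv : v < 0 := by by_contra! h; exact hF ⟨fun _ => hu, fun _ => h⟩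
    exact ⟨by nlinarith, hv.ne⟩
  · right
    have hv : 0 ≤ v := by
      by_contra! h; exact hF ⟨fun h' => by omega, fun h' => by omega⟩
    exact ⟨by nlinarith, hu.ne⟩

/-- The character of `SL(2)` counting walls modulo `2`. -/
noncomputable def wallHom (a b : ℤ) [hD : Fact (b ^ 2 + 4 * a < 0)] :
    Matrix.SpecialLinearGroup (Fin 2) (QuadraticAlgebra ℤ a b) →* Multiplicative (ZMod 2) :=
  flowHom (rowAction a b) (positiveWalls a b) almostInvariant_positiveWalls

theorem wallHom_eq_flow {S : Set ((Fin 2 → QuadraticAlgebra ℤ a b) → ℤ)}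
    (h : {F | ¬ (F ∈ positiveWalls a b ↔ F ∈ S)}.Finite) (g : 𝓖) :
    wallHom a b g = .ofAdd (flow (rowAction a b) S g) := by
  rw [← flow_congr almostInvariant_positiveWalls h]
  rfl

theorem wallHom_neg_one : wallHom a b (-1) = 1 := by
  rw [wallHom_eq_flow (S := positiveWalls a b) (by simp), flow, ofAdd_eq_one]
  refine finsum_eq_zero_of_forall_eq_zero fun F => ?_
  have hinv : ((-1 : 𝓖)⁻¹) = -1 := by
    rw [inv_eq_iff_mul_eq_one]; simp
  have : rowAction a b (-1) F ∈ positiveWalls a b ↔ F ∈ positiveWalls a b := by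
    simp only [positiveWalls, Set.mem_ofPred_eq, rowAction_mem_walls]
    refine and_congr_right ?_
    rintro ⟨g, rfl⟩
    rw [rowAction_wall]
    have : wall (-1 * g) = wall g := by
      funext l
      simp [wall, Matrix.vecMul_neg]
    rw [this]
  rw [hinv]
  rw [bit_congr this, sub_self]

theorem isPrincipal_of_im_eq_zero {x y : 𝓠} (h : (x * star y).im = 0) :
    ∃ z, z ∣ x ∧ z ∣ y ∧ ∃ u v, z = u * x + v * y := by
  by_cases hy : y = 0
  · exact ⟨x, dvd_rfl, by simp [hy], 1, 0, by simp⟩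
  have hN : y.norm ≠ 0 := (norm_pos hy).ne'
  have hm : x * star y = ((x * star y).re : 𝓠) := by
    ext <;> simp [h]
  set m := (x * star y).re with hmdef
  have hNy : y * star y = ((y.norm : ℤ) : 𝓠) := by
    have := QuadraticAlgebra.algebraMap_norm_eq_mul_star y
    rw [← this]; simp
  have hrel : (y.norm : 𝓠) * x = m * y := by
    rw [← hNy, ← hm]; ring
  obtain ⟨d, m', n', hd0, hcop, hmm, hnn⟩ := Int.exists_gcd_one' (m := m) (n := y.norm)
    (Int.gcd_pos_of_ne_zero_right _ hN)
  have hd' : ((d : ℤ) : 𝓠) ≠ 0 := by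
    rw [Int.cast_ne_zero]; exact_mod_cast hd0.ne'
  have hrel' : (n' : 𝓠) * x = m' * y := by
    apply mul_left_cancel₀ hd'
    have e1 : (y.norm : 𝓠) = n' * (d : ℤ) := by
      rw [← Int.cast_mul, ← hnn]
    have e2 : (m : 𝓠) = m' * (d : ℤ) := by
      rw [← Int.cast_mul, ← hmm]
    rw [e1, e2] at hrel
    linear_combination hrel
  obtain ⟨u, v, huv⟩ := Int.isCoprime_iff_gcd_eq_one.2 hcop
  have huv' : (u : 𝓠) * m' + v * n' = 1 := by exact_mod_cast congrArg (Int.cast : ℤ → 𝓠) huv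
  refine ⟨u * x + v * y, ⟨m', ?_⟩, ⟨n', ?_⟩, u, v, rfl⟩
  · linear_combination -x * huv' + v * hrel'
  · linear_combination -y * huv' - u * hrel'

/-- A parabolic element fixing a row vector whose entries generate a nonprincipal ideal has trivial
character. -/
theorem wallHom_eq_one_of_fix {l : Fin 2 → QuadraticAlgebra ℤ a b}
    (hl : ¬ (Ideal.span {l 0, l 1}).IsPrincipal) {M : 𝓖} (hM : l ᵥ* M.1 = l) :
    wallHom a b M = 1 := by
  have hne : ∀ F ∈ walls a b, F l ≠ 0 := by
    rintro _ ⟨g, rfl⟩ h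
    apply hl
    obtain ⟨z, hx, hy, u, v, huv⟩ := isPrincipal_of_im_eq_zero h
    rw [vecMul_entry] at hx hy huv
    rw [vecMul_entry] at huv
    have hdet := det_eq_one g
    refine ⟨z, le_antisymm ?_ ?_⟩
    · rw [Ideal.span_le]
      rintro w (rfl | rfl)
      · refine Ideal.mem_span_singleton.2 ?_
        convert dvd_sub (hx.mul_left (g.1 1 1)) (hy.mul_left (g.1 1 0)) using 1
        linear_combination -(l 0) * hdet
      · refine Ideal.mem_span_singleton.2 ?_
        convert dvd_sub (hy.mul_left (g.1 0 0)) (hx.mul_left (g.1 0 1)) using 1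
        linear_combination -(l 1) * hdet
    · change Ideal.span {z} ≤ _
      rw [Ideal.span_singleton_le_iff_mem, Ideal.mem_span_pair, huv]
      exact ⟨u * g.1 0 0 + v * g.1 0 1, u * g.1 1 0 + v * g.1 1 1, by ring⟩
  have hfin : {F | ¬ (F ∈ positiveWalls a b ↔ F ∈ {F ∈ walls a b | 0 ≤ F l})}.Finite := by
    refine (finite_walls_separating (a := a) (b := b) l 0).subset ?_
    intro F hF
    have hmem : F ∈ walls a b := by
      by_contra h
      exact hF ⟨fun h' => (h h'.1).elim, fun h' => (h h'.1).elim⟩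
    have h0 : F 0 = 0 := by
      obtain ⟨g, rfl⟩ := hmem
      simp [wall]
    have h1 := hne F hmem
    simp only [positiveWalls, Set.mem_ofPred_eq, hmem, true_and] at hF
    simp only [Set.mem_ofPred_eq, hmem, true_and, h0, add_zero]
    refine ⟨?_, h1⟩
    generalize F ![1, 0] + F ![0, 1] = u at *
    rcases le_or_gt 0 u with hu | hu
    · have hv : F l < 0 := by by_contra! h; exact hF ⟨fun _ => h, fun _ => hu⟩
      nlinarith
    · have hv : 0 ≤ F l := by
        by_contra! h; exact hF ⟨fun h' => by omega, fun h' => by omega⟩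
      nlinarith
  rw [wallHom_eq_flow hfin, flow, ofAdd_eq_one]
  refine finsum_eq_zero_of_forall_eq_zero fun F => ?_
  have hM' : l ᵥ* (M⁻¹).1 = l := by
    conv_lhs => rw [← hM]
    rw [Matrix.vecMul_vecMul, ← Matrix.SpecialLinearGroup.coe_mul, mul_inv_cancel,
      Matrix.SpecialLinearGroup.coe_one, Matrix.vecMul_one]
  have : rowAction a b M⁻¹ F ∈ {F ∈ walls a b | 0 ≤ F l} ↔ F ∈ {F ∈ walls a b | 0 ≤ F l} := by
    simp only [Set.mem_ofPred_eq, rowAction_mem_walls, rowAction_apply, hM']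
  rw [bit_congr this, sub_self]

theorem offDiag_eq_one (h7 : b ^ 2 + 4 * a < -4) {g : 𝓖}
    (hg : wall g ![0, 1] = 0) : offDiag g = 1 := by
  have hN := wall_det g
  rw [hg, mul_zero, mul_zero, sub_zero] at hN
  have h4 := four_mul_norm (offDiag g)
  have him : (offDiag g).im = 0 := by
    by_contra h0
    have : 1 ≤ (offDiag g).im ^ 2 := by
      rw [← sq_abs]; nlinarith [Int.one_le_abs h0]
    nlinarith [sq_nonneg (2 * (offDiag g).re + b * (offDiag g).im)]
  have hre : (offDiag g).re = 1 ∨ (offDiag g).re = -1 := by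
    rw [him, hN] at h4
    have : ((offDiag g).re - 1) * ((offDiag g).re + 1) = 0 := by linarith
    rcases mul_eq_zero.1 this with h | h
    · left; omega
    · right; omega
  rcases hre with hre | hre
  · ext <;> simp [him, hre]
  · exfalso
    have hB : offDiag g = -1 := by ext <;> simp [him, hre]
    have hdet := det_eq_one g
    have hst : ∀ x : 𝓠, star x = x - x.im * (⟨-b, 2⟩ : 𝓠) := by
      intro x
      ext
      · simp
        ring
      · simp
        ring
    have key : (-2 : 𝓠) = (⟨-b, 2⟩ : 𝓠) *
        (g.1 0 1 * (g.1 1 0).im - g.1 0 0 * (g.1 1 1).im) := by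
      rw [offDiag, hst, hst] at hB
      linear_combination hdet - hB
    have hnorm := congrArg QuadraticAlgebra.norm key
    rw [map_mul] at hnorm
    generalize g.1 0 1 * (g.1 1 0).im - g.1 0 0 * (g.1 1 1).im = w at *
    have h1 : (-2 : 𝓠).norm = 4 := by simp [QuadraticAlgebra.norm_def]
    have h2 : (⟨-b, 2⟩ : 𝓠).norm = -(b ^ 2 + 4 * a) := by
      simp [QuadraticAlgebra.norm_def]; ring
    rw [h1, h2] at hnorm
    have := norm_nonneg w
    rcases this.eq_or_lt with h | h
    · rw [← h] at hnorm; omega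
    · nlinarith

theorem wallHom_upper_omega (h7 : b ^ 2 + 4 * a < -4) :
    wallHom a b (upper ⟨0, 1⟩) = .ofAdd 1 := by
  set S : Set ((Fin 2 → 𝓠) → ℤ) :=
    {F ∈ walls a b | 0 < F ![0, 1] ∨ F ![0, 1] = 0 ∧ 0 ≤ F ![1, 0]} with hS
  have hfin : {F | ¬ (F ∈ positiveWalls a b ↔ F ∈ S)}.Finite := by
    refine (finite_walls_separating (a := a) (b := b) ![0, 1] 0).subset ?_
    intro F hF
    have hmem : F ∈ walls a b := by
      by_contra h
      exact hF ⟨fun h' => (h h'.1).elim, fun h' => (h h'.1).elim⟩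
    have h0 : F 0 = 0 := by
      obtain ⟨g, rfl⟩ := hmem
      simp [wall]
    simp only [positiveWalls, hS, Set.mem_ofPred_eq, hmem, true_and] at hF
    simp only [Set.mem_ofPred_eq, hmem, true_and, h0, add_zero]
    generalize F ![1, 0] = u at *
    generalize F ![0, 1] = v at *
    have hv : v ≠ 0 := by rintro rfl; simp at hF
    refine ⟨?_, hv⟩
    by_contra! hpos
    rcases pos_and_pos_or_neg_and_neg_of_mul_pos hpos with h | h <;> omega
  rw [wallHom_eq_flow hfin, flow]
  congr 1
  have hinv : (upper ⟨0, 1⟩ : 𝓖)⁻¹ = upper (-⟨0, 1⟩) := by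
    rw [inv_eq_iff_mul_eq_one, upper_mul_upper, add_neg_cancel]
    apply sl_ext <;> simp [upper]
  have hlow : ∀ F : (Fin 2 → 𝓠) → ℤ,
      rowAction a b (upper ⟨0, 1⟩)⁻¹ F ![0, 1] = F ![0, 1] := by
    intro F
    rw [rowAction_apply, hinv]
    congr 1
    funext i
    fin_cases i <;> simp [vecMul_entry, upper]
  have hup : ∀ F ∈ walls a b, F ![0, 1] = 0 →
      rowAction a b (upper ⟨0, 1⟩)⁻¹ F ![1, 0] = F ![1, 0] + 1 := by
    rintro _ ⟨g, rfl⟩ h0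
    have e : (![1, 0] ᵥ* (upper (-⟨0, 1⟩) : 𝓖).1 : Fin 2 → 𝓠) = ![1, -⟨0, 1⟩] := by
      funext i
      fin_cases i <;> simp [vecMul_entry, upper]
    rw [rowAction_apply, hinv, e, wall_apply, h0, offDiag_eq_one h7 h0]
    simp
  have hw0 : wall (upper ⟨0, 1⟩ : 𝓖) ![0, 1] = 0 := by
    rw [wall_lower]; simp [upper]
  have hw1 : wall (upper ⟨0, 1⟩ : 𝓖) ![1, 0] = -1 := by
    rw [wall_upper]; simp [upper]
  rw [finsum_eq_single _ (wall (upper ⟨0, 1⟩))]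
  · have h1 : rowAction a b (upper ⟨0, 1⟩)⁻¹ (wall (upper ⟨0, 1⟩)) ∈ S := by
      refine ⟨(rowAction_mem_walls _).2 ⟨_, rfl⟩, Or.inr ⟨?_, ?_⟩⟩
      · rw [hlow, hw0]
      · rw [hup _ ⟨_, rfl⟩ hw0, hw1]; norm_num
    have h2 : wall (upper ⟨0, 1⟩ : 𝓖) ∉ S := by
      rintro ⟨-, h | h⟩
      · omega
      · omega
    rw [bit, bit, if_pos h1, if_neg h2, sub_zero]
  · intro F hF
    have : rowAction a b (upper ⟨0, 1⟩)⁻¹ F ∈ S ↔ F ∈ S := by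
      simp only [hS, Set.mem_ofPred_eq, rowAction_mem_walls, hlow]
      refine and_congr_right fun hmem => or_congr_right (and_congr_right fun h0 => ?_)
      rw [hup F hmem h0]
      suffices F ![1, 0] ≠ -1 by omega
      intro h1
      apply hF
      obtain ⟨g, rfl⟩ := hmem
      exact wall_ext (h1.trans hw1.symm) (h0.trans hw0.symm)
        ((offDiag_eq_one h7 h0).trans (offDiag_eq_one h7 hw0).symm)
    rw [bit_congr this, sub_self]

end

section

/-- A nonprincipal ideal class contains ideals with generators adapted to a given modulus. -/
theorem exists_span_pair_not_isPrincipal {R : Type*} [CommRing R] [IsDedekindDomain R]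
    {I : Ideal R} (hI : ¬ I.IsPrincipal) {n : R} (hn : n ≠ 0) :
    ∃ s t, n ∣ t ∧ IsCoprime s n ∧ ¬ (Ideal.span {t, s}).IsPrincipal := by
  have hI0 : I ≠ ⊥ := by rintro rfl; exact hI bot_isPrincipal
  have hI1 : I ≠ ⊤ := by rintro rfl; exact hI top_isPrincipal
  obtain ⟨x, hxI, hx0⟩ := Submodule.exists_mem_ne_zero_of_ne_bot hI0
  set m := n * x with hm
  have hm0 : m ≠ 0 := mul_ne_zero hn hx0
  have hmI : m ∈ I := I.mul_mem_left n hxI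
  have hspan : Ideal.span {m} ≠ ⊥ := by simpa [Ideal.span_singleton_eq_bot] using hm0
  obtain ⟨r, hr⟩ := IsDedekindDomain.exists_sup_span_eq (I := Ideal.span {m} * I) (J := I)
    Ideal.mul_le_right (mul_ne_zero hspan hI0)
  have hr0 : r ≠ 0 := by
    rintro rfl
    rw [Ideal.span_singleton_zero, sup_bot_eq] at hr
    have := mul_right_cancel₀ hI0 (hr.trans (one_mul I).symm)
    exact hI1 ((Ideal.eq_top_iff_one _).2
      ((Ideal.span_singleton_le_iff_mem I).2 hmI
        (this ▸ Ideal.one_eq_top (R := R) ▸ Submodule.mem_top)))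
  have hrI : Ideal.span {r} ≤ I := le_sup_right.trans hr.le
  obtain ⟨c, hc⟩ := Ideal.dvd_iff_le.2 hrI
  have hcop : Ideal.span {m} ⊔ c = ⊤ := by
    apply mul_right_cancel₀ hI0
    rw [Ideal.sup_mul, mul_comm c I, ← hc, hr, Ideal.top_mul]
  have hc0 : c ≠ ⊥ := by
    rintro rfl
    rw [Ideal.mul_bot, Ideal.span_singleton_eq_bot] at hc
    exact hr0 hc
  have hcP : ¬ c.IsPrincipal := by
    rintro ⟨z, rfl⟩
    change Ideal.span {r} = I * Ideal.span {z} at hc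
    have hz : Ideal.span {z} ≠ ⊥ := hc0
    obtain ⟨w, rfl⟩ : z ∣ r := by
      rw [← Ideal.mem_span_singleton]
      exact (hc.le.trans Ideal.mul_le_right) (Ideal.mem_span_singleton_self r)
    rw [mul_comm z w, ← Ideal.span_singleton_mul_span_singleton] at hc
    exact hI ⟨w, (mul_right_cancel₀ hz hc).symm⟩
  obtain ⟨y, hyc, hy0⟩ := Submodule.exists_mem_ne_zero_of_ne_bot hc0
  obtain ⟨s, hs⟩ := IsDedekindDomain.exists_sup_span_eq (I := Ideal.span {m * y}) (J := c)
    ((Ideal.span_singleton_le_iff_mem c).2 (c.mul_mem_left m hyc))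
    (by simpa [Ideal.span_singleton_eq_bot] using ⟨hm0, hy0⟩)
  refine ⟨s, m * y, ⟨x * y, by rw [hm]; ring⟩, ?_, ?_⟩
  · have h1 : Ideal.span {n} ⊔ Ideal.span {s} = ⊤ := by
      rw [eq_top_iff, ← hcop, ← hs]
      refine sup_le (le_sup_of_le_left ?_) (sup_le (le_sup_of_le_left ?_) le_sup_right)
      · exact Ideal.span_singleton_le_span_singleton.2 ⟨x, rfl⟩
      · exact Ideal.span_singleton_le_span_singleton.2 ⟨x * y, by rw [hm]; ring⟩
    rw [sup_comm, ← Ideal.isCoprime_iff_sup_eq, Ideal.isCoprime_span_singleton_iff] at h1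
    exact h1
  · rwa [Ideal.span_insert, hs]

variable {a b : ℤ} [hD : Fact (b ^ 2 + 4 * a < 0)]

/-- If the ring is not principal, no principal congruence subgroup lies in the kernel of
the wall character. -/
theorem exists_wallHom_ne_one [IsDedekindDomain (QuadraticAlgebra ℤ a b)]
    (h7 : b ^ 2 + 4 * a < -4)
    {I : Ideal (QuadraticAlgebra ℤ a b)} (hI : ¬ I.IsPrincipal)
    {n : QuadraticAlgebra ℤ a b} (hn : n ≠ 0) :
    ∃ g : Matrix.SpecialLinearGroup (Fin 2) (QuadraticAlgebra ℤ a b),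
      (∀ i j, n ∣ g.1 i j - (1 : Matrix (Fin 2) (Fin 2) (QuadraticAlgebra ℤ a b)) i j) ∧
        wallHom a b g ≠ 1 := by
  obtain ⟨s, t, ⟨t', rfl⟩, ⟨u, v, huv⟩, hst⟩ := exists_span_pair_not_isPrincipal hI hn
  set ω : QuadraticAlgebra ℤ a b := ⟨0, 1⟩ with hω
  set y := u ^ 2 * ω with hy
  set t := n * t' with ht
  let M : Matrix.SpecialLinearGroup (Fin 2) (QuadraticAlgebra ℤ a b) :=
    sl (1 - y * s * t) (y * s ^ 2) (-(y * t ^ 2)) (1 + y * s * t) (by ring)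
  have hM : wallHom a b M = 1 := by
    apply wallHom_eq_one_of_fix (l := ![t, -s])
    · have : Ideal.span {![t, -s] 0, ![t, -s] 1} = Ideal.span {t, s} := by
        simp [Ideal.span_insert, Ideal.span_singleton_neg]
      rwa [this]
    · funext i
      fin_cases i <;> simp [M, sl] <;> ring
  refine ⟨upper (-ω) * M, ?_, ?_⟩
  · have key : y * s ^ 2 - ω = n * (-(v * ω) * (u * s + 1)) := by
      rw [hy]
      linear_combination (u * s + 1) * ω * huv
    intro i j
    fin_cases i <;> fin_cases j <;> simp only [mul_entry, upper, M] <;> simp [sl]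
    · exact ⟨-(y * s * t') + ω * y * t * t', by rw [ht]; ring⟩
    · exact ⟨-(v * ω) * (u * s + 1) - ω * y * s * t', by rw [ht]; linear_combination key⟩
    · exact ⟨y * t * t', by rw [ht]; ring⟩
    · exact ⟨y * s * t', by rw [ht]; ring⟩
  · have hinv : (upper ω * upper (-ω) :
        Matrix.SpecialLinearGroup (Fin 2) (QuadraticAlgebra ℤ a b)) = 1 := by
      rw [upper_mul_upper, add_neg_cancel]
      apply sl_ext <;> simp [upper]
    have h1 := congrArg (wallHom a b) hinv
    rw [map_mul, map_one, hω, wallHom_upper_omega h7] at h1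
    rw [map_mul, hM, mul_one]
    intro h2
    rw [h2, mul_one] at h1
    exact absurd h1 (by decide)

end

section

instance normal_sqSubgroup {G : Type*} [Group G] : (sqSubgroup G).Normal := by
  refine ⟨fun n hn g => ?_⟩
  have hle : sqSubgroup G ≤ (sqSubgroup G).comap (MulAut.conj g).toMonoidHom := by
    rw [sqSubgroup, Subgroup.closure_le]
    rintro _ ⟨y, rfl⟩
    refine Subgroup.subset_closure ⟨g * y * g⁻¹, ?_⟩
    rw [conj_pow]
    simp
  exact hle hn

theorem mk_mul_self_sqSubgroup {G : Type*} [Group G] (x : G ⧸ sqSubgroup G) : x * x = 1 := by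
  obtain ⟨y, rfl⟩ := QuotientGroup.mk_surjective x
  rw [← QuotientGroup.mk_mul, QuotientGroup.eq_one_iff]
  exact Subgroup.subset_closure ⟨y, (sq y).symm⟩

theorem sqSubgroup_le_ker {G A : Type*} [Group G] [Group A] (hA : ∀ x : A, x * x = 1)
    (χ : G →* A) : sqSubgroup G ≤ χ.ker := by
  rw [sqSubgroup, Subgroup.closure_le]
  rintro _ ⟨y, rfl⟩
  rw [SetLike.mem_coe, MonoidHom.mem_ker, map_pow, sq, hA]

/-- If the index is finite and less than twice the order of a quotient of exponent two, the
subgroup of squares is the kernel of the quotient map. -/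
theorem ker_le_sqSubgroup {G A : Type*} [Group G] [Group A] (hA : ∀ x : A, x * x = 1)
    {χ : G →* A} (hχ : Function.Surjective χ) (h0 : (sqSubgroup G).index ≠ 0)
    (hlt : (sqSubgroup G).index < 2 * Nat.card A) : χ.ker ≤ sqSubgroup G := by
  have h := Subgroup.relIndex_mul_index (sqSubgroup_le_ker hA χ)
  rw [Subgroup.index_ker, MonoidHom.range_eq_top.2 hχ, Subgroup.card_top] at h
  rw [← Subgroup.relIndex_eq_one]
  have h1 : (sqSubgroup G).relIndex χ.ker ≠ 0 := by
    intro h1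
    rw [h1, zero_mul] at h
    exact h0 h.symm
  have h2 : (sqSubgroup G).relIndex χ.ker < 2 := by
    by_contra! h2
    exact absurd (h ▸ Nat.mul_le_mul_right _ h2) hlt.not_ge
  omega

theorem isDedekindDomain_of_ringEquiv {R S : Type*} [CommRing R] [CommRing S] [IsDedekindDomain R]
    (e : R ≃+* S) : IsDedekindDomain S := by
  have : IsDomain S := e.symm.toMulEquiv.isDomain
  have : IsIntegrallyClosed S := IsIntegrallyClosed.of_equiv e
  have : IsNoetherianRing S := isNoetherianRing_of_ringEquiv R e
  have : Ring.DimensionLEOne S := by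
    refine ⟨fun {P} hP hprime => ?_⟩
    have hne : P.comap (e : R →+* S) ≠ ⊥ := by
      rw [Submodule.ne_bot_iff] at hP ⊢
      obtain ⟨x, hx, hx0⟩ := hP
      exact ⟨e.symm x, by simpa [Ideal.mem_comap, -Ideal.symm_apply_mem_of_equiv_iff] using hx,
        by simpa using hx0⟩
    exact (Ideal.isMaximal_comap_iff_of_bijective (e : R →+* S) e.bijective).1
      (Ring.DimensionLEOne.maximalOfPrime hne (hprime.comap _))
  exact { }

section NumberField

variable {K : Type*} [Field K] [NumberField K] {R : Type*} [CommRing R]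

theorem map_symm_map (e : 𝓞 K ≃+* R) (g : Matrix.SpecialLinearGroup (Fin 2) (𝓞 K)) :
    Matrix.SpecialLinearGroup.map (e.symm : R →+* 𝓞 K)
      (Matrix.SpecialLinearGroup.map (e : 𝓞 K →+* R) g) = g := by
  apply sl_ext <;> simp

theorem map_map_symm (e : 𝓞 K ≃+* R) (g : Matrix.SpecialLinearGroup (Fin 2) R) :
    Matrix.SpecialLinearGroup.map (e : 𝓞 K →+* R)
      (Matrix.SpecialLinearGroup.map (e.symm : R →+* 𝓞 K) g) = g := by
  apply sl_ext <;> simp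

theorem proj_surjective : Function.Surjective (proj K) := QuotientGroup.mk'_surjective _

theorem exists_hom_psl (e : 𝓞 K ≃+* R) {A : Type*} [Group A]
    {χ : Matrix.SpecialLinearGroup (Fin 2) R →* A}
    (hχ : χ (-1) = 1) : ∃ χ' : PSL K →* A, ∀ g,
      χ' (proj K g) = χ (Matrix.SpecialLinearGroup.map (e : 𝓞 K →+* R) g) := by
  have h : PM K ≤ (χ.comp (Matrix.SpecialLinearGroup.map (e : 𝓞 K →+* R))).ker := by
    rw [PM, Subgroup.closure_le, Set.singleton_subset_iff, SetLike.mem_coe, MonoidHom.mem_ker,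
      MonoidHom.comp_apply, ← hχ]
    congr 1
    apply sl_ext <;> simp
  exact ⟨QuotientGroup.lift (PM K) _ h, fun g => QuotientGroup.lift_mk' (PM K) h g⟩

theorem exists_natCast_of_isCongruence (e : 𝓞 K ≃+* R) {H : Subgroup (PSL K)}
    (hH : IsCongruence K H) :
    ∃ n : ℕ, n ≠ 0 ∧ ∀ g : Matrix.SpecialLinearGroup (Fin 2) R,
      (∀ i j, (n : R) ∣ g.1 i j - (1 : Matrix (Fin 2) (Fin 2) R) i j) →
        proj K (Matrix.SpecialLinearGroup.map (e.symm : R →+* 𝓞 K) g) ∈ H := by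
  obtain ⟨π, hπ, hle⟩ := hH
  refine ⟨Ideal.absNorm π, mt Ideal.absNorm_eq_zero_iff.1 hπ, fun g hg => hle ⟨_, ?_, rfl⟩⟩
  rw [SetLike.mem_coe, Subgroup.mem_comap]
  have hmem : ∀ i j, Ideal.Quotient.mk π (e.symm (g.1 i j)) =
      Ideal.Quotient.mk π (e.symm ((1 : Matrix (Fin 2) (Fin 2) R) i j)) := by
    intro i j
    rw [Ideal.Quotient.eq, ← map_sub]
    obtain ⟨c, hc⟩ := hg i j
    rw [hc, map_mul, map_natCast]
    exact π.mul_mem_right _ (Ideal.absNorm_mem π)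
  have : red K π (Matrix.SpecialLinearGroup.map (e.symm : R →+* 𝓞 K) g) = 1 := by
    apply sl_ext
    · simpa [red] using hmem 0 0
    · simpa [red] using hmem 0 1
    · simpa [red] using hmem 1 0
    · simpa [red] using hmem 1 1
  rw [this]
  exact one_mem _

/-- Exponent two characters trivial on `-1` are trivial on a principal congruence subgroup as soon
as the subgroup of squares is a congruence subgroup. -/
theorem exists_natCast_hom_eq_one (e : 𝓞 K ≃+* R) (h : IsCongruence K (sqSubgroup (PSL K)))
    {A : Type*} [Group A] (hA : ∀ x : A, x * x = 1)
    {χ : Matrix.SpecialLinearGroup (Fin 2) R →* A} (hχ : χ (-1) = 1) :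
    ∃ n : ℕ, n ≠ 0 ∧ ∀ g : Matrix.SpecialLinearGroup (Fin 2) R,
      (∀ i j, (n : R) ∣ g.1 i j - (1 : Matrix (Fin 2) (Fin 2) R) i j) → χ g = 1 := by
  obtain ⟨n, hn, hg⟩ := exists_natCast_of_isCongruence e h
  obtain ⟨χ', hχ'⟩ := exists_hom_psl e hχ
  refine ⟨n, hn, fun g h => ?_⟩
  have := sqSubgroup_le_ker hA χ' (hg g h)
  rwa [MonoidHom.mem_ker, hχ', map_map_symm] at this

theorem isCongruence_of_mod_two (e : 𝓞 K ≃+* R) {A : Type*} [Group A] (hA : ∀ x : A, x * x = 1)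
    {ψ : Matrix.SpecialLinearGroup (Fin 2) R →* A} (hψ : Function.Surjective ψ)
    (h2 : ∀ g h : Matrix.SpecialLinearGroup (Fin 2) R,
      (∀ i j, (2 : R) ∣ g.1 i j - h.1 i j) → ψ g = ψ h)
    (h0 : (sqSubgroup (PSL K)).index ≠ 0)
    (hlt : (sqSubgroup (PSL K)).index < 2 * Nat.card A) :
    IsCongruence K (sqSubgroup (PSL K)) := by
  have hneg : ψ (-1) = 1 := by
    rw [← map_one ψ]
    refine h2 _ _ fun i j => ⟨-(1 : Matrix (Fin 2) (Fin 2) R) i j, ?_⟩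
    simp only [Matrix.SpecialLinearGroup.coe_neg, Matrix.SpecialLinearGroup.coe_one,
      Matrix.neg_apply]
    ring
  obtain ⟨ψ', hψ'⟩ := exists_hom_psl e hneg
  have hsurj : Function.Surjective ψ' := by
    intro x
    obtain ⟨g, rfl⟩ := hψ x
    exact ⟨proj K (Matrix.SpecialLinearGroup.map (e.symm : R →+* 𝓞 K) g),
      by rw [hψ', map_map_symm]⟩
  refine ⟨Ideal.span {2}, by simp, le_trans ?_ (ker_le_sqSubgroup hA hsurj h0 hlt)⟩
  rintro _ ⟨g, hg, rfl⟩
  have hneg1 : (-1 : Matrix.SpecialLinearGroup (Fin 2) (𝓞 K ⧸ Ideal.span {(2 : 𝓞 K)})) = 1 := by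
    have h : (-1 : 𝓞 K ⧸ Ideal.span {(2 : 𝓞 K)}) = 1 := by
      have : Ideal.Quotient.mk (Ideal.span {(2 : 𝓞 K)}) 2 = 0 :=
        Ideal.Quotient.eq_zero_iff_mem.2 (Ideal.mem_span_singleton_self _)
      rw [map_ofNat] at this
      rw [neg_eq_iff_add_eq_zero, one_add_one_eq_two, this]
    apply sl_ext <;> simp [h]
  rw [SetLike.mem_coe, Subgroup.mem_comap, hneg1, Subgroup.closure_singleton_one,
    Subgroup.mem_bot] at hg
  rw [MonoidHom.mem_ker, hψ', ← map_one ψ]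
  refine h2 _ _ fun i j => ?_
  have h1 : Ideal.Quotient.mk (Ideal.span {(2 : 𝓞 K)}) (g.1 i j) =
      Ideal.Quotient.mk (Ideal.span {(2 : 𝓞 K)}) ((1 : Matrix (Fin 2) (Fin 2) (𝓞 K)) i j) := by
    have := congrArg (fun m => m.1 i j) hg
    rw [← map_one (red K _)] at this
    exact this
  rw [Ideal.Quotient.eq, Ideal.mem_span_singleton] at h1
  have h3 := map_dvd e h1
  rw [map_sub, map_ofNat] at h3
  convert h3 using 2
  · rfl
  rw [Matrix.SpecialLinearGroup.coe_one]
  by_cases hij : i = j <;> simp [Matrix.one_apply, hij]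

/-- The quotient map from `SL(2, R)` to the quotient of `PSL(2)` by its squares. -/
noncomputable def quotientSq (e : 𝓞 K ≃+* R) :
    Matrix.SpecialLinearGroup (Fin 2) R →* PSL K ⧸ sqSubgroup (PSL K) :=
  (QuotientGroup.mk' (sqSubgroup (PSL K))).comp
    ((proj K).comp (Matrix.SpecialLinearGroup.map (e.symm : R →+* 𝓞 K)))

theorem quotientSq_surjective (e : 𝓞 K ≃+* R) : Function.Surjective (quotientSq e) := by
  intro x
  obtain ⟨y, rfl⟩ := QuotientGroup.mk'_surjective _ x
  obtain ⟨g, rfl⟩ := proj_surjective y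
  exact ⟨Matrix.SpecialLinearGroup.map (e : 𝓞 K →+* R) g, by
    rw [quotientSq, MonoidHom.comp_apply, MonoidHom.comp_apply, map_symm_map]⟩

theorem exists_ideal_not_isPrincipal (e : 𝓞 K ≃+* R) (h : 3 ≤ NumberField.classNumber K) :
    ∃ I : Ideal R, ¬ I.IsPrincipal := by
  by_contra! hI
  have : IsPrincipalIdealRing R := ⟨hI⟩
  have : IsPrincipalIdealRing (𝓞 K) :=
    IsPrincipalIdealRing.of_surjective (e.symm : R →+* 𝓞 K) e.symm.surjective
  rw [NumberField.classNumber_eq_one_iff.2 this] at h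
  omega

end NumberField

open scoped QuadraticAlgebra in
theorem isPrincipalIdealRing_gaussian : IsPrincipalIdealRing (QuadraticAlgebra ℤ (-1) 0) := by
  let f : GaussianInt →+* QuadraticAlgebra ℤ (-1) 0 :=
    Zsqrtd.lift ⟨⟨0, 1⟩, by ext <;> simp⟩
  refine IsPrincipalIdealRing.of_surjective f fun x => ⟨⟨x.re, x.im⟩, ?_⟩
  ext <;> simp [f]

end

end ImagQuad

/-- **Proposition 6.3.** Let `d < 0` be squarefree with `d ≢ 5 (mod 8)`, and let
`B_d = PSL(2, O_d)` where `O_d` is the ring of integers of `K = ℚ(√d)`.  Then the power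
subgroup `B_d² = ⟨x² : x ∈ B_d⟩` is a non-congruence subgroup of `B_d` iff
`[B_d : B_d²] ≥ 8`.  Moreover, if the class number of `O_d` is at least `3`, then `B_d²`
is non-congruence. -/
theorem bianchi_squares_noncongruence
    (d : ℤ) (hd : d < 0) (hdsf : Squarefree d) (hd8 : d % 8 ≠ 5)
    (hK2 : Module.finrank ℚ K = 2) (α : K) (hα : α ^ 2 = (d : K)) :
    (¬ IsCongruence K (sqSubgroup (PSL K)) ↔ 8 ≤ (sqSubgroup (PSL K)).index) ∧
      (3 ≤ NumberField.classNumber K → ¬ IsCongruence K (sqSubgroup (PSL K))) := by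
  obtain ⟨a, b, hD', hb, ⟨e⟩⟩ := ImagQuad.exists_ringEquiv hd hdsf hd8 hK2 hα
  have hD : Fact (b ^ 2 + 4 * a < 0) := ⟨hD'⟩
  have : IsIntegrallyClosed (QuadraticAlgebra ℤ a b) := IsIntegrallyClosed.of_equiv e
  have hA : (sqSubgroup (PSL K)).index ≠ 0 := by
    have := ImagQuad.finite_of_sq_eq_one ImagQuad.mk_mul_self_sqSubgroup _
      (ImagQuad.quotientSq_surjective e)
    rw [Subgroup.index]
    exact Nat.card_pos.ne'
  refine ⟨⟨fun h => ?_, fun h hcong => ?_⟩, fun hcl hcong => ?_⟩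
  · by_contra! hlt
    obtain ⟨ψ, hψ, h2⟩ := ImagQuad.exists_surjective_mod_two hb
    refine h (ImagQuad.isCongruence_of_mod_two e (fun x => ?_) hψ h2 hA ?_)
    · revert x; decide
    · simpa [Nat.card_prod] using hlt
  · obtain ⟨n, hn, hker⟩ := ImagQuad.exists_natCast_of_isCongruence e hcong
    have := ImagQuad.card_le_four ImagQuad.mk_mul_self_sqSubgroup _
      (ImagQuad.quotientSq_surjective e) hn fun g hg =>
        (QuotientGroup.eq_one_iff _).2 (hker g hg)
    rw [Subgroup.index] at h
    omega
  · obtain ⟨I, hI⟩ := ImagQuad.exists_ideal_not_isPrincipal e hcl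
    have : IsDedekindDomain (QuadraticAlgebra ℤ a b) := ImagQuad.isDedekindDomain_of_ringEquiv e
    have h7 : b ^ 2 + 4 * a < -4 := by
      by_contra! h7
      have hab : a = -1 ∧ b = 0 := by
        rcases hb with rfl | ⟨rfl, hb⟩ <;> omega
      obtain ⟨rfl, rfl⟩ := hab
      exact hI (ImagQuad.isPrincipalIdealRing_gaussian.principal I)
    obtain ⟨n, hn, hg⟩ := ImagQuad.exists_natCast_hom_eq_one e hcong
      (by decide) (ImagQuad.wallHom_neg_one (a := a) (b := b))
    have hn' : ((n : ℤ) : QuadraticAlgebra ℤ a b) ≠ 0 := by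
      rw [Int.cast_ne_zero]; exact_mod_cast hn
    rw [Int.cast_natCast] at hn'
    obtain ⟨g, hgn, hne⟩ := ImagQuad.exists_wallHom_ne_one h7 hI hn'
    exact hne (hg g hgn)
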